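/- arXiv:2501.18114 — 12 statements merged into one kernel-verified Lean document; each statement's English description precedes it below -/
import Mathlib

section
/- Convergence of the DCatalyst outer loop for strongly convex objectives (Proposition 1, stated with the inexactness bound that Assumption 3 and the termination rule (9) imply). Let d, m ≥ 1 be integers, μ > 0, δ > 0, ε₀ > 0, c ∈ (0,1), and set α := √(μ/(μ+δ)) and μ_M := δμ/(δ+μ). Let u : ℝ^d → ℝ be convex and μ-strongly convex, with (unique) minimizer x⋆ ∈ ℝ^d. On a probability space, let x_i^k, z_i^k (i ∈ {1,…,m}, k ≥ 0) be square-integrable ℝ^d-valued random sequences such that: (a) x_i^0 = z_i^0 are deterministic and (1/m)∑_{i=1}^m ‖x_i^0 − x̄^0‖² ≤ ε₀, where x̄^0 := (1/m)∑_{i=1}^m x_i^0; (b) almost surely z_i^{k+1} = x_i^{k+1} + ((1−α)/(1+α))·(x_i^{k+1} − x_i^k) for all i and all k ≥ 0; (c) for all k ≥ 0, (1/m)∑_{i=1}^m E[‖x_i^{k+1} − x⋆_{z^k}‖²] ≤ ε₀(1−cα)^{k+1}, where z^k := (z_1^k,…,z_m^k). Then for every k ≥ 0, (1/m)∑_{i=1}^m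 E[‖x_i^k − x⋆‖²] ≤ c_scvx·(1−cα)^k, where c_scvx := (1/m)∑_{i=1}^m (2+δ/μ)‖x⋆−x_i^0‖² + (δ(μ_M+δ)/(μ_M²(1−c)))·∑_{i=1}^m ‖x⋆−x_i^0‖² + (δ/(μ_M(1−c)) + 2√(2000 m)·δ²/(μ_M²(1−c)²))·ε₀. -/
open MeasureTheory

section helpers
variable {E : Type*} [NormedAddCommGroup E] [InnerProductSpace ℝ E]

lemma aux_limit (C B : ℝ) (h : ∀ s : ℝ, 0 < s → s < 1 → 0 ≤ C + s * B) : 0 ≤ C := by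
  by_contra hC
  push Not at hC
  have hpos : 0 < |B| + -C + 1 := by linarith [abs_nonneg B]
  have h1 := h (-C / (2 * (|B| + -C + 1))) (by apply div_pos <;> linarith)
    (by rw [div_lt_one (by linarith)]; linarith [abs_nonneg B])
  have h2 : -C / (2 * (|B| + -C + 1)) * B ≤ -C / 2 := by
    rw [div_mul_eq_mul_div, div_le_div_iff₀ (by linarith) (by norm_num)]
    nlinarith [le_abs_self B]
  linarith

lemma aux_subgrad (μ δ : ℝ) (u : E → ℝ)
    (hs : ConvexOn ℝ Set.univ (fun x => u x - μ / 2 * ‖x‖ ^ 2)) (p y : E)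
    (hp : ∀ v, u p + δ / 2 * ‖p - y‖ ^ 2 ≤ u v + δ / 2 * ‖v - y‖ ^ 2) (v : E) :
    u p + δ * inner ℝ (y - p) (v - p) + μ / 2 * ‖v - p‖ ^ 2 ≤ u v := by
  have key := aux_limit
    (u v - u p - δ * inner ℝ (y - p) (v - p) - μ / 2 * ‖v - p‖ ^ 2)
    ((μ / 2 + δ / 2) * ‖v - p‖ ^ 2) (by
      intro s h0 h1
      have hc := hs.2 (Set.mem_univ p) (Set.mem_univ v) (by linarith : 0 ≤ 1 - s) h0.le (by ring)
      have hm := hp ((1 - s) • p + s • v)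
      simp only [smul_eq_mul, ← real_inner_self_eq_norm_sq, inner_add_left, inner_add_right,
        inner_sub_left, inner_sub_right, real_inner_smul_left, real_inner_smul_right,
        real_inner_comm p v, real_inner_comm p y, real_inner_comm y v] at hc hm ⊢
      refine nonneg_of_mul_nonneg_right (a := s) ?_ h0
      nlinarith [hc, hm])
  linarith

/-- The Moreau envelope value attached to the prox map `p`. -/
noncomputable def auxM (δ : ℝ) (u : E → ℝ) (p : E → E) (y : E) : ℝ :=
  u (p y) + δ / 2 * ‖p y - y‖ ^ 2

lemma auxM_smooth (δ : ℝ) (u : E → ℝ) (p : E → E)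
    (hp : ∀ y v, u (p y) + δ / 2 * ‖p y - y‖ ^ 2 ≤ u v + δ / 2 * ‖v - y‖ ^ 2) (y e : E) :
    auxM δ u p (y + e) ≤ auxM δ u p y + δ * inner ℝ (y - p y) e + δ / 2 * ‖e‖ ^ 2 := by
  have h := hp (y + e) (p y)
  unfold auxM
  refine h.trans (le_of_eq ?_)
  have : p y - (y + e) = -((y - p y) + e) := by abel
  rw [this, norm_neg, norm_add_sq_real, ← norm_neg (p y - y), neg_sub]
  ring

lemma auxM_strong (μ δ : ℝ) (hμ : 0 < μ) (hδ : 0 < δ) (u : E → ℝ) (p : E → E)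
    (hs : ConvexOn ℝ Set.univ (fun x => u x - μ / 2 * ‖x‖ ^ 2))
    (hp : ∀ y v, u (p y) + δ / 2 * ‖p y - y‖ ^ 2 ≤ u v + δ / 2 * ‖v - y‖ ^ 2) (y y' : E) :
    auxM δ u p y + δ * inner ℝ (y - p y) (y' - y) + δ * μ / (δ + μ) / 2 * ‖y' - y‖ ^ 2
      ≤ auxM δ u p y' := by
  have h := aux_subgrad μ δ u hs (p y) y (hp y) (p y')
  unfold auxM
  have hsq : 0 ≤ ‖(δ + μ) • (p y' - p y) - δ • (y' - y)‖ ^ 2 := by positivity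
  obtain ⟨D, hD⟩ : ∃ D, D = p y' - p y := ⟨_, rfl⟩
  obtain ⟨T, hT⟩ : ∃ T, T = y' - y := ⟨_, rfl⟩
  obtain ⟨g, hg⟩ : ∃ g, g = y - p y := ⟨_, rfl⟩
  have e1 : p y' - y' = D - T - g := by rw [hD, hT, hg]; abel
  have e2 : p y - y = -g := by rw [hg]; abel
  rw [e1, e2]
  rw [← hD, ← hg] at h
  rw [← hD, ← hT] at hsq
  rw [← hT, ← hg, norm_neg]
  have key : δ * μ / (δ + μ) / 2 * ‖T‖ ^ 2 ≤ μ / 2 * ‖D‖ ^ 2 + δ / 2 * ‖D - T‖ ^ 2 := by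
    have hpos : 0 < δ + μ := by linarith
    have : μ / 2 * ‖D‖ ^ 2 + δ / 2 * ‖D - T‖ ^ 2 - δ * μ / (δ + μ) / 2 * ‖T‖ ^ 2
        = ‖(δ + μ) • D - δ • T‖ ^ 2 / (2 * (δ + μ)) := by
      simp only [← real_inner_self_eq_norm_sq, inner_sub_left, inner_sub_right,
        real_inner_smul_left, real_inner_smul_right, real_inner_comm T D]
      field_simp
      ring
    have : 0 ≤ ‖(δ + μ) • D - δ • T‖ ^ 2 / (2 * (δ + μ)) := by positivity
    linarith
  have e3 : ‖D - T - g‖ ^ 2 = ‖D - T‖ ^ 2 - 2 * (inner ℝ g D - inner ℝ g T) + ‖g‖ ^ 2 := by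
    rw [norm_sub_sq_real, real_inner_comm, inner_sub_right]
  rw [e3]
  nlinarith [h, key]

lemma aux_young (t : ℝ) (ht : 0 < t) (a e : E) :
    inner ℝ a e ≤ t / 2 * ‖a‖ ^ 2 + 1 / t / 2 * ‖e‖ ^ 2 := by
  have h : t / 2 * ‖a‖ ^ 2 + 1 / t / 2 * ‖e‖ ^ 2 - inner ℝ a e = ‖t • a - e‖ ^ 2 / (2 * t) := by
    simp only [← real_inner_self_eq_norm_sq, inner_sub_left, inner_sub_right,
      real_inner_smul_left, real_inner_smul_right, real_inner_comm a e]
    field_simp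
    ring
  have : 0 ≤ ‖t • a - e‖ ^ 2 / (2 * t) := by positivity
  linarith

/-- Lyapunov function. -/
noncomputable def auxV (δ α : ℝ) (u : E → ℝ) (p : E → E) (xs x y : E) : ℝ :=
  auxM δ u p x - u xs + δ / 2 * ‖(1 + α) • y - x - α • xs‖ ^ 2

lemma aux_step (μ δ α t : ℝ) (hμ : 0 < μ) (hδ : 0 < δ) (ha0 : 0 < α) (ha1 : α < 1) (ht : 0 < t)
    (hα : δ * μ / (δ + μ) = δ * α ^ 2) (u : E → ℝ) (p : E → E)
    (hs : ConvexOn ℝ Set.univ (fun x => u x - μ / 2 * ‖x‖ ^ 2))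
    (hp : ∀ y v, u (p y) + δ / 2 * ‖p y - y‖ ^ 2 ≤ u v + δ / 2 * ‖v - y‖ ^ 2)
    (xs : E) (hxs : ∀ x, u xs ≤ u x) (x y x' y' : E)
    (hy' : y' = x' + ((1 - α) / (1 + α)) • (x' - x)) :
    auxV δ α u p xs x' y' ≤ (1 + t) * (1 - α) * auxV δ α u p xs x y
      + (1 + 1 / t) * δ * ‖x' - p y‖ ^ 2 := by
  obtain ⟨e, he⟩ : ∃ e, e = x' - p y := ⟨_, rfl⟩
  have hx' : x' = p y + e := by rw [he]; abel
  rw [← he]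
  have hw : (1 + α) • y' - x' - α • xs = (p y - (1 - α) • x - α • xs) + e := by
    have h1 : (1 + α) * ((1 - α) / (1 + α)) = 1 - α := by field_simp
    rw [hy', smul_add, smul_smul, h1, hx']
    module
  have hexact : auxM δ u p (p y) - u xs + δ / 2 * ‖p y - (1 - α) • x - α • xs‖ ^ 2
      ≤ (1 - α) * auxV δ α u p xs x y := by
    have s1 := auxM_smooth δ u p hp y (p y - y)
    have c1 := auxM_strong μ δ hμ hδ u p hs hp y x
    have c2 := auxM_strong μ δ hμ hδ u p hs hp y xs
    have c3 : auxM δ u p xs ≤ u xs := by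
      have := hp xs xs
      simpa [auxM] using this
    rw [hα] at c1 c2
    rw [add_sub_cancel] at s1
    have hn : 0 ≤ δ / 2 * (α * (1 - α ^ 2)) * ‖x - y‖ ^ 2 := by
      have : 0 ≤ 1 - α ^ 2 := by nlinarith
      positivity
    obtain ⟨a, ha⟩ : ∃ a, a = x - xs := ⟨_, rfl⟩
    obtain ⟨b, hb⟩ : ∃ b, b = y - xs := ⟨_, rfl⟩
    obtain ⟨g, hg⟩ : ∃ g, g = y - p y := ⟨_, rfl⟩
    have i1 : p y - y = -g := by rw [hg]; abel
    have i2 : x - y = a - b := by rw [ha, hb]; abel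
    have i3 : xs - y = -b := by rw [hb]; abel
    have i4 : p y - (1 - α) • x - α • xs = b - g - (1 - α) • a := by
      rw [ha, hb, hg]; module
    have i5 : (1 + α) • y - x - α • xs = (1 + α) • b - a := by
      rw [ha, hb]; module
    unfold auxV
    rw [i1, ← hg] at s1
    rw [i2, ← hg] at c1
    rw [i3, ← hg] at c2
    rw [i2] at hn
    rw [i4, i5]
    have c1' := mul_le_mul_of_nonneg_left c1 (by linarith : 0 ≤ 1 - α)
    have c2' := mul_le_mul_of_nonneg_left (c2.trans c3) ha0.le
    simp only [norm_neg, ← real_inner_self_eq_norm_sq, inner_sub_left, inner_sub_right,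
        inner_neg_right,
        real_inner_smul_left, real_inner_smul_right, real_inner_comm a b,
        real_inner_comm g a, real_inner_comm g b] at s1 c1' c2' hn ⊢
    nlinarith [s1, c1', c2', hn]
  have hM : auxM δ u p x' - u xs ≤ (1 + t) * (auxM δ u p (p y) - u xs)
      + (1 + 1 / t) * (δ / 2 * ‖e‖ ^ 2) := by
    have s := auxM_smooth δ u p hp (p y) e
    rw [← hx'] at s
    have l : u xs + δ / 2 * ‖p y - p (p y)‖ ^ 2 ≤ auxM δ u p (p y) := by
      unfold auxM
      rw [norm_sub_rev]
      linarith [hxs (p (p y))]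
    have yg := aux_young t ht (p y - p (p y)) e
    have yg' := mul_le_mul_of_nonneg_left yg hδ.le
    have l' := mul_le_mul_of_nonneg_left l ht.le
    nlinarith [s, yg', l']
  have hQ : ‖(p y - (1 - α) • x - α • xs) + e‖ ^ 2
      ≤ (1 + t) * ‖p y - (1 - α) • x - α • xs‖ ^ 2 + (1 + 1 / t) * ‖e‖ ^ 2 := by
    rw [norm_add_sq_real]
    have yg := aux_young t ht (p y - (1 - α) • x - α • xs) e
    nlinarith [yg]
  have hQ' := mul_le_mul_of_nonneg_left hQ (by linarith : 0 ≤ δ / 2)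
  have hE := mul_le_mul_of_nonneg_left hexact (by linarith : 0 ≤ 1 + t)
  have : auxV δ α u p xs x' y' = auxM δ u p x' - u xs
      + δ / 2 * ‖(p y - (1 - α) • x - α • xs) + e‖ ^ 2 := by
    unfold auxV; rw [hw]
  rw [this]
  nlinarith [hM, hQ', hE]

lemma aux_mean (m : ℕ) (hm : 1 ≤ m) (z : Fin m → E) (v : E) :
    ∑ i, ‖v - z i‖ ^ 2 = m * ‖v - (m : ℝ)⁻¹ • ∑ j, z j‖ ^ 2
      + ∑ i, ‖(m : ℝ)⁻¹ • ∑ j, z j - z i‖ ^ 2 := by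
  have hm0 : (m : ℝ) ≠ 0 := by positivity
  obtain ⟨b, hb⟩ : ∃ b, b = (m : ℝ)⁻¹ • ∑ j, z j := ⟨_, rfl⟩
  rw [← hb]
  have h0 : ∑ i, (b - z i) = 0 := by
    rw [Finset.sum_sub_distrib, Finset.sum_const, Finset.card_univ, Fintype.card_fin,
      ← Nat.cast_smul_eq_nsmul ℝ, hb, smul_smul, mul_inv_cancel₀ hm0, one_smul, sub_self]
  have h1 : ∀ i, ‖v - z i‖ ^ 2 = ‖v - b‖ ^ 2 + 2 * inner ℝ (v - b) (b - z i) + ‖b - z i‖ ^ 2 := by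
    intro i
    rw [← norm_add_sq_real]; congr 2; abel
  simp only [h1, Finset.sum_add_distrib, ← Finset.mul_sum, ← inner_sum, h0, inner_zero_right]
  simp

end helpers

set_option maxHeartbeats 2000000 in
/-- **Convergence of the DCatalyst outer loop for strongly convex objectives**
(Proposition 1). Let `u` be convex and `μ`-strongly convex with minimizer `x⋆`, let
`α := √(μ/(μ+δ))` and `μ_M := δμ/(δ+μ)`, and let `x⋆_z` denote the minimizer of
`u_z(x) := u(x) + (δ/(2m))∑_i ‖x−z_i‖²`. Suppose the square-integrable random sequences
`x_i^k, z_i^k` satisfy the deterministic consensus-bounded initialization (a), the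
extrapolation step (b), and the inexactness bound (c):
`(1/m)∑_i E[‖x_i^{k+1}−x⋆_{z^k}‖²] ≤ ε₀(1−cα)^{k+1}`. Then
`(1/m)∑_i E[‖x_i^k−x⋆‖²] ≤ c_scvx (1−cα)^k` with the explicit constant `c_scvx`. -/
theorem dcatalyst_outer_loop_strongly_convex
    (d m : ℕ) (hd : 1 ≤ d) (hm : 1 ≤ m)
    (μ δ ε₀ c : ℝ) (hμ : 0 < μ) (hδ : 0 < δ) (hε₀ : 0 < ε₀)
    (hc : c ∈ Set.Ioo (0 : ℝ) 1)
    (α μM : ℝ) (hα : α = Real.sqrt (μ / (μ + δ))) (hμM : μM = δ * μ / (δ + μ))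
    (u : EuclideanSpace ℝ (Fin d) → ℝ)
    (hconv : ConvexOn ℝ Set.univ u)
    (hsconv : ConvexOn ℝ Set.univ (fun x => u x - μ / 2 * ‖x‖ ^ 2))
    (xstar : EuclideanSpace ℝ (Fin d))
    (hxstar : ∀ x, u xstar ≤ u x)
    -- the (unique) minimizer of the proximal subproblem `u_z`
    (xz : (Fin m → EuclideanSpace ℝ (Fin d)) → EuclideanSpace ℝ (Fin d))
    (hxz : ∀ (zz : Fin m → EuclideanSpace ℝ (Fin d)) (y : EuclideanSpace ℝ (Fin d)),
      u (xz zz) + δ / (2 * m) * ∑ i, ‖xz zz - zz i‖ ^ 2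
        ≤ u y + δ / (2 * m) * ∑ i, ‖y - zz i‖ ^ 2)
    -- probability space and random sequences
    {Ω : Type*} [MeasurableSpace Ω] (P : Measure Ω) [IsProbabilityMeasure P]
    (x z : ℕ → Fin m → Ω → EuclideanSpace ℝ (Fin d))
    (hint₁ : ∀ k i, Integrable (fun ω => ‖x k i ω - xstar‖ ^ 2) P)
    (hint₂ : ∀ k i,
      Integrable (fun ω => ‖x (k + 1) i ω - xz (fun j => z k j ω)‖ ^ 2) P)
    -- (a) deterministic initialization, consensus error at most ε₀
    (x0 : Fin m → EuclideanSpace ℝ (Fin d))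
    (hx0 : ∀ i ω, x 0 i ω = x0 i) (hz0 : ∀ i ω, z 0 i ω = x0 i)
    (hx0cons : 1 / (m : ℝ) * ∑ i, ‖x0 i - (m : ℝ)⁻¹ • ∑ j, x0 j‖ ^ 2 ≤ ε₀)
    -- (b) extrapolation step
    (hextra : ∀ i k, ∀ᵐ ω ∂P,
      z (k + 1) i ω
        = x (k + 1) i ω + ((1 - α) / (1 + α)) • (x (k + 1) i ω - x k i ω))
    -- (c) inexactness of the inner loop
    (hinexact : ∀ k,
      1 / (m : ℝ) * ∑ i, ∫ ω, ‖x (k + 1) i ω - xz (fun j => z k j ω)‖ ^ 2 ∂P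
        ≤ ε₀ * (1 - c * α) ^ (k + 1)) :
    ∀ k, 1 / (m : ℝ) * ∑ i, ∫ ω, ‖x k i ω - xstar‖ ^ 2 ∂P
      ≤ (1 / (m : ℝ) * ∑ i, (2 + δ / μ) * ‖xstar - x0 i‖ ^ 2
          + δ * (μM + δ) / (μM ^ 2 * (1 - c)) * ∑ i, ‖xstar - x0 i‖ ^ 2
          + (δ / (μM * (1 - c))
              + 2 * Real.sqrt (2000 * m) * δ ^ 2 / (μM ^ 2 * (1 - c) ^ 2)) * ε₀)
        * (1 - c * α) ^ k := by
  have hm0 : (0 : ℝ) < m := by exact_mod_cast hm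
  obtain ⟨hc0, hc1⟩ := hc
  have hq0 : 0 < μ / (μ + δ) := by positivity
  have ha0 : 0 < α := by rw [hα]; exact Real.sqrt_pos.mpr hq0
  have hasq : α ^ 2 = μ / (μ + δ) := by rw [hα]; exact Real.sq_sqrt hq0.le
  have ha1 : α < 1 := by
    have : α ^ 2 < 1 := by rw [hasq, div_lt_one (by linarith)]; linarith
    nlinarith
  have hμMα : δ * μ / (δ + μ) = δ * α ^ 2 := by rw [hasq, add_comm δ μ]; ring
  have hμM' : μM = δ * α ^ 2 := by rw [hμM, hμMα]
  -- prox map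
  obtain ⟨p, hpdef⟩ : ∃ p : EuclideanSpace ℝ (Fin d) → EuclideanSpace ℝ (Fin d),
    p = fun y => xz (fun _ => y) := ⟨_, rfl⟩
  have hp : ∀ y v, u (p y) + δ / 2 * ‖p y - y‖ ^ 2 ≤ u v + δ / 2 * ‖v - y‖ ^ 2 := by
    intro y v
    have h := hxz (fun _ => y) v
    simp only [Finset.sum_const, Finset.card_univ, Fintype.card_fin, nsmul_eq_mul] at h
    have e : ∀ r : ℝ, δ / (2 * m) * (m * r) = δ / 2 * r := by
      intro r; field_simp
    rw [e, e] at h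
    rw [hpdef]; exact h
  have hpz : ∀ zz : Fin m → EuclideanSpace ℝ (Fin d), xz zz = p ((m : ℝ)⁻¹ • ∑ j, zz j) := by
    intro zz
    obtain ⟨b, hb⟩ : ∃ b, b = (m : ℝ)⁻¹ • ∑ j, zz j := ⟨_, rfl⟩
    have h1 : ∀ v, u (xz zz) + δ / 2 * ‖xz zz - b‖ ^ 2 ≤ u v + δ / 2 * ‖v - b‖ ^ 2 := by
      intro v
      have h := hxz zz v
      rw [aux_mean m hm zz v, aux_mean m hm zz (xz zz), ← hb] at h
      have e : ∀ r s : ℝ, δ / (2 * m) * (m * r + s) = δ / 2 * r + δ / (2 * m) * s := by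
        intro r s; field_simp
      rw [e, e] at h
      linarith
    rw [← hb]
    have s1 := aux_subgrad μ δ u hsconv _ b h1 (p b)
    have s2 := aux_subgrad μ δ u hsconv _ b (hp b) (xz zz)
    have e1 : inner ℝ (b - xz zz) (p b - xz zz) + inner ℝ (b - p b) (xz zz - p b)
        = ‖xz zz - p b‖ ^ 2 := by
      have : b - xz zz = (b - p b) - (xz zz - p b) := by abel
      rw [this, ← neg_sub (xz zz) (p b), inner_neg_right, inner_sub_left,
        real_inner_self_eq_norm_sq]
      ring
    rw [norm_sub_rev] at s1
    have h3 : ‖xz zz - p b‖ ^ 2 ≤ 0 := by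
      by_contra hcon
      push Not at hcon
      have := mul_pos hδ hcon
      have := mul_pos hμ hcon
      nlinarith
    have h4 : ‖xz zz - p b‖ = 0 := by
      have := sq_nonneg ‖xz zz - p b‖
      exact pow_eq_zero_iff (two_ne_zero) |>.mp (le_antisymm h3 this)
    exact sub_eq_zero.mp (norm_eq_zero.mp h4)
  have hps : p xstar = xstar := by
    have h := hp xstar xstar
    have h2 := hxstar (p xstar)
    simp only [sub_self, norm_zero] at h
    have h3 : ‖p xstar - xstar‖ ^ 2 ≤ 0 := by
      by_contra hcon
      push Not at hcon
      have := mul_pos hδ hcon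
      nlinarith
    have h4 : ‖p xstar - xstar‖ = 0 :=
      pow_eq_zero_iff (two_ne_zero) |>.mp (le_antisymm h3 (sq_nonneg _))
    exact sub_eq_zero.mp (norm_eq_zero.mp h4)
  -- lower bound on Lyapunov function
  have hVlow : ∀ a b, δ * α ^ 2 / 2 * ‖a - xstar‖ ^ 2 ≤ auxV δ α u p xstar a b := by
    intro a b
    have h := auxM_strong μ δ hμ hδ u p hsconv hp xstar a
    rw [hμMα, hps] at h
    have h2 : auxM δ u p xstar = u xstar := by simp [auxM, hps]
    rw [h2] at h
    simp only [sub_self, inner_zero_left, mul_zero, add_zero] at h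
    have h3 : 0 ≤ δ / 2 * ‖(1 + α) • b - a - α • xstar‖ ^ 2 := by positivity
    unfold auxV
    linarith
  -- mean iterates, errors
  obtain ⟨xb, hxb⟩ : ∃ xb : ℕ → Ω → EuclideanSpace ℝ (Fin d),
    xb = fun k ω => (m : ℝ)⁻¹ • ∑ j, x k j ω := ⟨_, rfl⟩
  obtain ⟨zb, hzb⟩ : ∃ zb : ℕ → Ω → EuclideanSpace ℝ (Fin d),
    zb = fun k ω => (m : ℝ)⁻¹ • ∑ j, z k j ω := ⟨_, rfl⟩
  obtain ⟨Err, hErr⟩ : ∃ Err : ℕ → Ω → ℝ, Err = fun k ω =>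
    1 / (m : ℝ) * ∑ i, ‖x (k + 1) i ω - xz (fun j => z k j ω)‖ ^ 2 := ⟨_, rfl⟩
  have hErrInt : ∀ k, Integrable (Err k) P := by
    intro k
    rw [hErr]
    exact (integrable_finsetSum _ (fun i _ => hint₂ k i)).const_mul _
  have hErrB : ∀ k, ∫ ω, Err k ω ∂P ≤ ε₀ * (1 - c * α) ^ (k + 1) := by
    intro k
    refine le_trans (le_of_eq ?_) (hinexact k)
    rw [hErr]
    simp only
    rw [integral_const_mul, integral_finsetSum _ (fun i _ => hint₂ k i)]
  have hxzb : ∀ k ω, xz (fun j => z k j ω) = p (zb k ω) := by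
    intro k ω; rw [hpz, hzb]
  have hErrEq : ∀ k ω, Err k ω = ‖xb (k + 1) ω - p (zb k ω)‖ ^ 2
      + 1 / (m : ℝ) * ∑ i, ‖xb (k + 1) ω - x (k + 1) i ω‖ ^ 2 := by
    intro k ω
    have h := aux_mean m hm (fun i => x (k + 1) i ω) (p (zb k ω))
    rw [hErr]
    simp only
    rw [hxzb]
    simp only [norm_sub_rev _ (p (zb k ω))]
    rw [h, hxb]
    field_simp
  have hxEq : ∀ k ω, 1 / (m : ℝ) * ∑ i, ‖x k i ω - xstar‖ ^ 2 = ‖xb k ω - xstar‖ ^ 2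
      + 1 / (m : ℝ) * ∑ i, ‖xb k ω - x k i ω‖ ^ 2 := by
    intro k ω
    have h := aux_mean m hm (fun i => x k i ω) xstar
    simp only [norm_sub_rev _ xstar]
    rw [h, hxb]
    field_simp
  have hzrec : ∀ k, ∀ᵐ ω ∂P, zb (k + 1) ω
      = xb (k + 1) ω + ((1 - α) / (1 + α)) • (xb (k + 1) ω - xb k ω) := by
    intro k
    filter_upwards [ae_all_iff.mpr (fun i => hextra i k)] with ω hω
    rw [hzb, hxb]
    simp only [hω, Finset.sum_add_distrib, ← Finset.smul_sum, Finset.sum_sub_distrib]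
    module
  -- constants
  obtain ⟨t, ht⟩ : ∃ t, t = (1 - c) * α / 2 := ⟨_, rfl⟩
  have ht0 : 0 < t := by
    have : 0 < 1 - c := by linarith
    rw [ht]; positivity
  have ht1 : t ≤ 1 / 2 := by rw [ht]; nlinarith
  obtain ⟨S, hS⟩ : ∃ S, S = ∑ i, ‖xstar - x0 i‖ ^ 2 := ⟨_, rfl⟩
  have hS0 : 0 ≤ S := by rw [hS]; positivity
  obtain ⟨B, hB⟩ : ∃ B, B = δ / 2 * (1 + α ^ 2) * (S / m) := ⟨_, rfl⟩
  have hB0 : 0 ≤ B := by rw [hB]; positivity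
  obtain ⟨W, hW0, hWs⟩ : ∃ W : ℕ → Ω → ℝ, (∀ ω, W 0 ω = B) ∧
      (∀ k ω, W (k + 1) ω = (1 + t) * (1 - α) * W k ω + (1 + 1 / t) * δ * Err k ω) :=
    ⟨fun k => Nat.rec (fun _ => B)
      (fun k w ω => (1 + t) * (1 - α) * w ω + (1 + 1 / t) * δ * Err k ω) k,
      fun _ => rfl, fun _ _ => rfl⟩
  have hWs' : ∀ k, W (k + 1) =
      fun ω => (1 + t) * (1 - α) * W k ω + (1 + 1 / t) * δ * Err k ω := by
    intro k; funext ω; exact hWs k ω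
  have hWint : ∀ k, Integrable (W k) P := by
    intro k
    induction k with
    | zero =>
      have : W 0 = fun _ => B := by funext ω; exact hW0 ω
      rw [this]; exact integrable_const _
    | succ k ih =>
      rw [hWs']
      exact (ih.const_mul _).add ((hErrInt k).const_mul _)
  have hVW : ∀ k, ∀ᵐ ω ∂P, auxV δ α u p xstar (xb k ω) (zb k ω) ≤ W k ω := by
    intro k
    induction k with
    | zero =>
      refine Filter.Eventually.of_forall (fun ω => ?_)
      rw [hW0]
      have e : zb 0 ω = xb 0 ω := by rw [hzb, hxb]; simp only [hx0, hz0]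
      rw [e]
      have h1 := hp (xb 0 ω) xstar
      have h2 : (1 + α) • xb 0 ω - xb 0 ω - α • xstar = α • (xb 0 ω - xstar) := by module
      have h3 : ‖xb 0 ω - xstar‖ ^ 2 ≤ S / m := by
        have h := aux_mean m hm x0 xstar
        have e2 : xb 0 ω = (m : ℝ)⁻¹ • ∑ j, x0 j := by rw [hxb]; simp only [hx0]
        have h4 : 0 ≤ ∑ i, ‖(m : ℝ)⁻¹ • ∑ j, x0 j - x0 i‖ ^ 2 := by positivity
        rw [le_div_iff₀ hm0, hS, h, e2, norm_sub_rev]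
        linarith
      unfold auxV auxM
      rw [h2, norm_smul, mul_pow, Real.norm_eq_abs, sq_abs, hB]
      rw [norm_sub_rev xstar] at h1
      have h5 := mul_le_mul_of_nonneg_left h3 (by positivity : 0 ≤ δ / 2 * (1 + α ^ 2))
      linarith
    | succ k ih =>
      filter_upwards [ih, hzrec k] with ω h1 h2
      have h := aux_step μ δ α t hμ hδ ha0 ha1 ht0 hμMα u p hsconv hp xstar hxstar
        (xb k ω) (zb k ω) (xb (k + 1) ω) (zb (k + 1) ω) h2
      rw [hWs]
      refine h.trans ?_
      have h3 : ‖xb (k + 1) ω - p (zb k ω)‖ ^ 2 ≤ Err k ω := by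
        rw [hErrEq]
        have : 0 ≤ 1 / (m : ℝ) * ∑ i, ‖xb (k + 1) ω - x (k + 1) i ω‖ ^ 2 := by positivity
        linarith
      have h4 : 0 ≤ 1 - α := by linarith
      gcongr
  obtain ⟨r, hr⟩ : ∃ r, r = 1 - c * α := ⟨_, rfl⟩
  have hr0 : 0 < r := by rw [hr]; nlinarith
  have hr1 : r ≤ 1 := by rw [hr]; nlinarith
  obtain ⟨K, hK⟩ : ∃ K, K = B + 3 / 2 * δ * ε₀ / t ^ 2 := ⟨_, rfl⟩
  have hK0 : 0 ≤ K := by rw [hK]; positivity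
  have hstep : (1 + t) * (1 - α) * K + (1 + 1 / t) * δ * ε₀ * r ≤ K * r := by
    have h1 : (1 + 1 / t) * δ * ε₀ ≤ t * K := by
      have : t * K = t * B + 3 / 2 * (δ * ε₀ / t) := by rw [hK]; field_simp
      rw [this]
      have h2 : (1 + 1 / t) * δ * ε₀ = (1 + t) * (δ * ε₀ / t) := by field_simp; ring
      rw [h2]
      have h3 : 0 ≤ δ * ε₀ / t := by positivity
      have h4 : 0 ≤ t * B := by positivity
      nlinarith
    have h5 : (1 + t) * (1 - α) ≤ r - t := by rw [hr]; nlinarith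
    have h6 := mul_le_mul_of_nonneg_right h5 hK0
    have h7 : (1 + 1 / t) * δ * ε₀ * r ≤ (1 + 1 / t) * δ * ε₀ :=
      mul_le_of_le_one_right (by positivity) hr1
    nlinarith
  have hWB : ∀ k, ∫ ω, W k ω ∂P ≤ K * r ^ k := by
    intro k
    induction k with
    | zero =>
      simp only [hW0, integral_const, probReal_univ, one_smul, pow_zero, mul_one]
      rw [hK]
      have : 0 ≤ 3 / 2 * δ * ε₀ / t ^ 2 := by positivity
      linarith
    | succ k ih =>
      rw [hWs' k, integral_add ((hWint k).const_mul _) ((hErrInt k).const_mul _),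
        integral_const_mul, integral_const_mul]
      have h1 := hErrB k
      rw [← hr] at h1
      have h4 : 0 ≤ 1 - α := by linarith
      calc _ ≤ (1 + t) * (1 - α) * (K * r ^ k) + (1 + 1 / t) * δ * (ε₀ * r ^ (k + 1)) := by
            gcongr
        _ = ((1 + t) * (1 - α) * K + (1 + 1 / t) * δ * ε₀ * r) * r ^ k := by ring
        _ ≤ (K * r) * r ^ k := by gcongr
        _ = _ := by ring
  -- final bounds
  rw [← hr, ← Finset.mul_sum, ← hS]
  have hc1' : 0 < 1 - c := by linarith
  have hq : δ / μ = 1 / α ^ 2 - 1 := by rw [hasq]; field_simp; ring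
  have hfin : 2 / (δ * α ^ 2) * K + ε₀ ≤ 1 / (m : ℝ) * ((2 + δ / μ) * S)
      + δ * (μM + δ) / (μM ^ 2 * (1 - c)) * S
      + (δ / (μM * (1 - c))
        + 2 * Real.sqrt (2000 * m) * δ ^ 2 / (μM ^ 2 * (1 - c) ^ 2)) * ε₀ := by
    have f1 : 2 / (δ * α ^ 2) * K = 1 / (m : ℝ) * ((2 + δ / μ) * S)
        + 12 / (α ^ 4 * (1 - c) ^ 2) * ε₀ := by
      rw [hK, hB, ht, hq]; field_simp; ring
    have f2 : 0 ≤ δ * (μM + δ) / (μM ^ 2 * (1 - c)) * S := by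
      rw [hμM']; positivity
    have f3 : 1 ≤ δ / (μM * (1 - c)) := by
      have : δ / (μM * (1 - c)) = 1 / (α ^ 2 * (1 - c)) := by rw [hμM']; field_simp
      rw [this, le_div_iff₀ (by positivity), one_mul]
      exact mul_le_one₀ (pow_le_one₀ ha0.le ha1.le) hc1'.le (by linarith)
    have f4 : 12 / (α ^ 4 * (1 - c) ^ 2)
        ≤ 2 * Real.sqrt (2000 * m) * δ ^ 2 / (μM ^ 2 * (1 - c) ^ 2) := by
      have : 2 * Real.sqrt (2000 * m) * δ ^ 2 / (μM ^ 2 * (1 - c) ^ 2)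
        = 2 * Real.sqrt (2000 * m) / (α ^ 4 * (1 - c) ^ 2) := by rw [hμM']; field_simp
      rw [this]
      have h6 : 6 ≤ Real.sqrt (2000 * m) := by
        apply Real.le_sqrt_of_sq_le
        have : (1 : ℝ) ≤ m := by exact_mod_cast hm
        linarith
      gcongr
      linarith
    rw [f1]
    have f5 := mul_le_mul_of_nonneg_right (add_le_add f3 f4) hε₀.le
    linarith
  intro k
  refine le_trans ?_ (mul_le_mul_of_nonneg_right hfin (by positivity))
  rw [← integral_finsetSum _ (fun i _ => hint₁ k i), ← integral_const_mul]
  have hLint : Integrable (fun ω => 1 / (m : ℝ) * ∑ i, ‖x k i ω - xstar‖ ^ 2) P :=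
    (integrable_finsetSum _ (fun i _ => hint₁ k i)).const_mul _
  have hxW : ∀ᵐ ω ∂P, ‖xb k ω - xstar‖ ^ 2 ≤ 2 / (δ * α ^ 2) * W k ω := by
    filter_upwards [hVW k] with ω hω
    have h := (hVlow (xb k ω) (zb k ω)).trans hω
    have h2 := mul_le_mul_of_nonneg_left h (by positivity : 0 ≤ 2 / (δ * α ^ 2))
    refine le_trans (le_of_eq ?_) h2
    field_simp
  cases k with
  | zero =>
    have hcons : ∀ ω, 1 / (m : ℝ) * ∑ i, ‖xb 0 ω - x 0 i ω‖ ^ 2 ≤ ε₀ := by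
      intro ω
      refine le_trans (le_of_eq ?_) hx0cons
      rw [hxb]
      simp only [hx0]
      simp only [norm_sub_rev]
    have hmono : ∫ ω, 1 / (m : ℝ) * ∑ i, ‖x 0 i ω - xstar‖ ^ 2 ∂P
        ≤ ∫ ω, (2 / (δ * α ^ 2) * W 0 ω + ε₀) ∂P := by
      refine integral_mono_ae hLint (((hWint 0).const_mul _).add (integrable_const _)) ?_
      filter_upwards [hxW] with ω hω
      rw [hxEq]
      linarith [hcons ω]
    refine hmono.trans ?_
    rw [integral_add ((hWint 0).const_mul _) (integrable_const _), integral_const_mul]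
    have h1 := mul_le_mul_of_nonneg_left (hWB 0) (by positivity : 0 ≤ 2 / (δ * α ^ 2))
    simp only [integral_const, probReal_univ, one_smul]
    simp only [pow_zero, mul_one] at h1 ⊢
    linarith
  | succ k =>
    have hmono : ∫ ω, 1 / (m : ℝ) * ∑ i, ‖x (k + 1) i ω - xstar‖ ^ 2 ∂P
        ≤ ∫ ω, (2 / (δ * α ^ 2) * W (k + 1) ω + Err k ω) ∂P := by
      refine integral_mono_ae hLint (((hWint (k + 1)).const_mul _).add (hErrInt k)) ?_
      filter_upwards [hxW] with ω hω
      rw [hxEq, hErrEq]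
      linarith [sq_nonneg ‖xb (k + 1) ω - p (zb k ω)‖]
    refine hmono.trans ?_
    rw [integral_add ((hWint (k + 1)).const_mul _) (hErrInt k), integral_const_mul]
    have h1 := mul_le_mul_of_nonneg_left (hWB (k + 1)) (by positivity : 0 ≤ 2 / (δ * α ^ 2))
    have h2 := hErrB k
    rw [← hr] at h2
    linarith
end

section
/- Convergence of the DCatalyst outer loop for (non-strongly) convex objectives (Proposition 3, stated with the inexactness bound that Assumption 3 and the termination rule (12) imply, and with the gradient of the Moreau envelope expressed through the proximal map). Let d, m ≥ 1, δ > 0, ε₀ > 0 and r₀ ∈ (0,1]. Let α^0 := (√5−1)/2 and, for k ≥ 1, let α^k be the unique solution in (0,1) of (α^k)² = (1−α^k)(α^{k−1})². Let u : ℝ^d → ℝ be convex and attain its minimum at some x⋆ ∈ ℝ^d. On a probability space, let x_i^k, z_i^k (i ∈ {1,…,m}, k ≥ 0) be square-integrable ℝ^d-valued random sequences such that: (a) x_i^0 = z_i^0 are deterministic and (1/m)∑_{i=1}^m ‖x_i^0 − x̄^0‖² ≤ ε₀, with x̄^0 := (1/m)∑_i x_i^0; (b) almost surely z_i^{k+1}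 = x_i^{k+1} + (α^k(1−α^k)/((α^k)²+α^{k+1}))·(x_i^{k+1} − x_i^k) for all i, k ≥ 0; (c) for all k ≥ 0, (1/m)∑_{i=1}^m E[‖x_i^{k+1} − x⋆_{z^k}‖²] ≤ ε₀/(k+3)^{4+2r₀}, where z^k := (z_1^k,…,z_m^k). Then for every k ≥ 0, (δ/(2m))∑_{i=1}^m E[‖x_i^k − prox_{(1/δ)u}(x_i^k)‖²] ≤ c_cvx/(k+2)², where c_cvx := (4/m)∑_{i=1}^m (δ‖x⋆−x_i^0‖² + 10·C_cvx/r₀), C_cvx := √(250·δ·m·ε₀·c_v), and c_v := (1/m)∑_{i=1}^m (8δ‖x⋆−x_i^0‖² + 9000·δ·m·ε₀·(1+1/r₀)²). Moreover, if in addition u is differentiable with L-Lipschitz gradient, then for every k ≥ 0, (1/(2δm))∑_{i=1}^m E[‖∇u(x_i^k)‖²] ≤ c_cvx(L+δ)²/(δ²(k+2)²). -/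
open MeasureTheory

set_option maxHeartbeats 800000

section Helpers

variable {E : Type*} [NormedAddCommGroup E] [InnerProductSpace ℝ E]

/-- Subgradient inequality at a proximal point. -/
lemma dc_subgrad {u : E → ℝ} (hconv : ConvexOn ℝ Set.univ u) {δ : ℝ} (hδ : 0 < δ) {p z : E}
    (hp : ∀ y, u p + δ / 2 * ‖p - z‖ ^ 2 ≤ u y + δ / 2 * ‖y - z‖ ^ 2) (w : E) :
    u p + δ * inner ℝ (z - p) (w - p) ≤ u w := by
  have key : ∀ s : ℝ, 0 < s → s ≤ 1 →
      u p + δ * inner ℝ (z - p) (w - p) ≤ u w + s * (δ / 2 * ‖w - p‖ ^ 2) := by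
    intro s hs hs1
    have h1 := hp ((1 - s) • p + s • w)
    have h2 := hconv.2 (Set.mem_univ p) (Set.mem_univ w) (by linarith : 0 ≤ 1 - s) hs.le
      (by ring)
    have h3 : (1 - s) • p + s • w - z = s • (w - p) - (z - p) := by module
    have h4 : ‖p - z‖ = ‖z - p‖ := norm_sub_rev _ _
    rw [h3, h4, norm_sub_sq_real (s • (w - p)), norm_smul, inner_smul_left,
      real_inner_comm (z - p) (w - p)] at h1
    simp only [smul_eq_mul, Real.norm_eq_abs, abs_of_pos hs, conj_trivial] at h1 h2
    have h5 : s * (u p + δ * inner ℝ (z - p) (w - p))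
        ≤ s * (u w + s * (δ / 2 * ‖w - p‖ ^ 2)) := by nlinarith
    exact le_of_mul_le_mul_left h5 hs
  by_contra! hcon
  set K := δ / 2 * ‖w - p‖ ^ 2 with hK
  have hK0 : 0 ≤ K := by positivity
  set g := u p + δ * inner ℝ (z - p) (w - p) - u w with hg
  have hg0 : 0 < g := by simp only [hg]; linarith
  have h1 := key (min 1 (g / (2 * (K + 1)))) (by positivity) (min_le_left _ _)
  have h2 : min 1 (g / (2 * (K + 1))) * K ≤ g / (2 * (K + 1)) * K :=
    mul_le_mul_of_nonneg_right (min_le_right _ _) hK0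
  have h3 : g / (2 * (K + 1)) * K ≤ g / 2 := by
    rw [div_mul_eq_mul_div, div_le_div_iff₀ (by positivity) (by positivity)]
    nlinarith
  linarith

/-- Lower model of the Moreau envelope. -/
lemma dc_lower {u : E → ℝ} (hconv : ConvexOn ℝ Set.univ u) {δ : ℝ} (hδ : 0 < δ) {p z : E}
    (hp : ∀ y, u p + δ / 2 * ‖p - z‖ ^ 2 ≤ u y + δ / 2 * ‖y - z‖ ^ 2) (y q : E) :
    u p + δ * inner ℝ (z - p) (y - p) - δ / 2 * ‖z - p‖ ^ 2 ≤ u q + δ / 2 * ‖q - y‖ ^ 2 := by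
  have h1 := dc_subgrad hconv hδ hp q
  have h2 : 0 ≤ ‖(q - y) + (z - p)‖ ^ 2 := by positivity
  rw [norm_add_sq_real] at h2
  have h3 : inner ℝ (z - p) (q - p) = inner ℝ (z - p) (y - p) + inner ℝ (q - y) (z - p) := by
    rw [real_inner_comm (z - p) (q - y), ← inner_add_right]
    congr 1; abel
  rw [h3] at h1
  nlinarith

/-- One exact step of the accelerated scheme. -/
lemma dc_step {u : E → ℝ} (hconv : ConvexOn ℝ Set.univ u) {δ : ℝ} (hδ : 0 < δ) {p z : E}
    (hp : ∀ y, u p + δ / 2 * ‖p - z‖ ^ 2 ≤ u y + δ / 2 * ‖y - z‖ ^ 2)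
    (xs x v q : E) (t : ℝ) (ht : 1 ≤ t) (hv : v - x = t • (z - x)) :
    t ^ 2 * (u p - u xs) + δ / 2 * ‖x + t • (p - x) - xs‖ ^ 2
      ≤ (t ^ 2 - t) * (u q + δ / 2 * ‖q - x‖ ^ 2 - u xs) + δ / 2 * ‖v - xs‖ ^ 2 := by
  have h1 := dc_lower hconv hδ hp x q
  have h2 := dc_lower hconv hδ hp xs xs
  simp only [sub_self, norm_zero] at h2
  have e1 : x + t • (p - x) - xs = (1 - t) • (x - p) - (xs - p) := by module
  have e2 : v - xs = (t • (z - p) + (1 - t) • (x - p)) - (xs - p) := by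
    have : v = t • (z - x) + x := by rw [← hv]; abel
    rw [this]; module
  rw [e1, e2]
  generalize z - p = G at *
  generalize x - p = b at *
  generalize xs - p = c at *
  have h3 : 0 ≤ t ^ 2 - t := by nlinarith
  have h4 := mul_le_mul_of_nonneg_left h1 h3
  have h5 := mul_le_mul_of_nonneg_left h2 (by linarith : 0 ≤ t)
  have e3 : ‖(t • G + (1 - t) • b) - c‖ ^ 2 = ‖(1 - t) • b - c‖ ^ 2 + t ^ 2 * ‖G‖ ^ 2
      + 2 * t * (1 - t) * inner ℝ G b - 2 * t * inner ℝ G c := by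
    have : (t • G + (1 - t) • b) - c = ((1 - t) • b - c) + t • G := by abel
    rw [this, norm_add_sq_real, norm_smul, mul_pow, Real.norm_eq_abs, sq_abs, real_inner_comm,
      inner_smul_left, inner_sub_right, inner_smul_right]
    simp only [conj_trivial]
    ring
  rw [e3]
  nlinarith

/-- One inexact step. -/
lemma dc_inexact {δ D Bd w t a W : ℝ} (hδ : 0 < δ) (hB : 0 ≤ Bd) (hw : 0 ≤ w) (hwa : w ≤ a)
    (ht : 0 ≤ t) (hD : 0 ≤ D) (hW : 0 ≤ W) (h : D + δ / 2 * W ^ 2 ≤ Bd ^ 2) :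
    D + δ / 2 * t ^ 2 * w ^ 2 + δ / 2 * (W + t * w) ^ 2 ≤ (Bd + Real.sqrt (2 * δ) * (t * a)) ^ 2 := by
  set c := Real.sqrt (2 * δ)
  have hc : c ^ 2 = 2 * δ := Real.sq_sqrt (by positivity)
  have hc0 : 0 ≤ c := Real.sqrt_nonneg _
  have h1 : c * W / 2 ≤ Bd := by
    apply le_of_sq_le_sq _ hB
    nlinarith
  have h2 : δ * W ≤ c * Bd := by nlinarith
  have h3 : δ * W * (t * w) ≤ c * Bd * (t * w) := mul_le_mul_of_nonneg_right h2 (by positivity)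
  have h4 : t * w ≤ t * a := mul_le_mul_of_nonneg_left hwa ht
  have h0 : 0 ≤ t * w := by positivity
  have h5 : (Bd + c * (t * w)) ^ 2 ≤ (Bd + c * (t * a)) ^ 2 := by
    gcongr
  have h6 : 0 ≤ c * Bd * (t * w) := by positivity
  have h7 : 0 ≤ δ * (t * w) ^ 2 := by positivity
  have h8 : (Bd + c * (t * w)) ^ 2 = Bd ^ 2 + 2 * (c * Bd * (t * w)) + 2 * (δ * (t * w) ^ 2) := by
    calc _ = Bd ^ 2 + 2 * (c * Bd * (t * w)) + c ^ 2 * (t * w) ^ 2 := by ring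
      _ = _ := by rw [hc]; ring
  nlinarith

lemma dc_var {m : ℕ} (hm : 1 ≤ m) (z : Fin m → E) (y : E) :
    1 / (m : ℝ) * ∑ i, ‖y - z i‖ ^ 2 = ‖y - (m : ℝ)⁻¹ • ∑ i, z i‖ ^ 2
      + 1 / (m : ℝ) * ∑ i, ‖(m : ℝ)⁻¹ • ∑ i, z i - z i‖ ^ 2 := by
  have hm0 : (m : ℝ) ≠ 0 := by positivity
  set b := (m : ℝ)⁻¹ • ∑ i, z i with hb
  have h1 : ∀ i, ‖y - z i‖ ^ 2 = ‖y - b‖ ^ 2 + 2 * inner ℝ (y - b) (b - z i) + ‖b - z i‖ ^ 2 := by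
    intro i
    rw [← norm_add_sq_real]; congr 2; abel
  have h2 : ∑ i, inner ℝ (y - b) (b - z i) = 0 := by
    rw [← inner_sum, Finset.sum_sub_distrib]
    have : ∑ i, z i = (m : ℝ) • b := by rw [hb, smul_smul, mul_inv_cancel₀ hm0, one_smul]
    rw [this]
    simp [← Nat.cast_smul_eq_nsmul ℝ]
  simp_rw [h1]
  rw [Finset.sum_add_distrib, Finset.sum_add_distrib, ← Finset.mul_sum, h2]
  simp
  field_simp

lemma dc_avg_le {m : ℕ} (hm : 1 ≤ m) (z : Fin m → E) (y : E) :
    ‖(m : ℝ)⁻¹ • ∑ i, z i - y‖ ^ 2 ≤ 1 / (m : ℝ) * ∑ i, ‖z i - y‖ ^ 2 := by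
  have h := dc_var hm z y
  simp_rw [norm_sub_rev y] at h
  rw [h]
  have : 0 ≤ 1 / (m : ℝ) * ∑ i, ‖(m : ℝ)⁻¹ • ∑ i, z i - z i‖ ^ 2 := by positivity
  linarith

/-- `xz` is the prox of the average. -/
lemma dc_xz {m : ℕ} (hm : 1 ≤ m) {u : E → ℝ} {δ : ℝ} (z : Fin m → E) (p : E)
    (h : ∀ y, u p + δ / (2 * m) * ∑ i, ‖p - z i‖ ^ 2 ≤ u y + δ / (2 * m) * ∑ i, ‖y - z i‖ ^ 2)
    (y : E) :
    u p + δ / 2 * ‖p - (m : ℝ)⁻¹ • ∑ i, z i‖ ^ 2 ≤ u y + δ / 2 * ‖y - (m : ℝ)⁻¹ • ∑ i, z i‖ ^ 2 := by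
  have hh := h y
  have e : ∀ S : ℝ, δ / (2 * m) * S = δ / 2 * (1 / (m : ℝ) * S) := by
    intro S; field_simp
  rw [e, e, dc_var hm z p, dc_var hm z y] at hh
  linarith

/-- The pathwise bound. -/
lemma dc_pathwise {m : ℕ} (hm : 1 ≤ m) {u : E → ℝ} (hconv : ConvexOn ℝ Set.univ u)
    {δ : ℝ} (hδ : 0 < δ) (xs : E) (hxs : ∀ y, u xs ≤ u y)
    (prox : E → E)
    (hprox : ∀ x y, u (prox x) + δ / 2 * ‖prox x - x‖ ^ 2 ≤ u y + δ / 2 * ‖y - x‖ ^ 2)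
    (T : ℕ → ℝ) (hT1 : ∀ k, 1 ≤ T k) (hT0 : T 0 ^ 2 - T 0 = 1)
    (hT : ∀ k, T (k + 1) ^ 2 - T (k + 1) = T k ^ 2)
    (x z : ℕ → Fin m → E) (p : ℕ → E)
    (hp : ∀ k y, u (p k) + δ / (2 * m) * ∑ i, ‖p k - z k i‖ ^ 2
      ≤ u y + δ / (2 * m) * ∑ i, ‖y - z k i‖ ^ 2)
    (hz0 : ∀ i, z 0 i = x 0 i)
    (hz : ∀ k i, T (k + 1) • (z (k + 1) i - x (k + 1) i) = (T k - 1) • (x (k + 1) i - x k i))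
    (a : ℕ → ℝ) (ha : ∀ k, 0 ≤ a k)
    (ha2 : ∀ k, a k ^ 2 = 1 / (m : ℝ) * ∑ i, ‖x (k + 1) i - p k‖ ^ 2)
    (R : ℝ) (hR : 0 ≤ R) (hR2 : R ^ 2 = 1 / (m : ℝ) * ∑ i, ‖xs - x 0 i‖ ^ 2) (k : ℕ) :
    T k ^ 2 * (δ / (2 * m) * ∑ i, ‖x (k + 1) i - prox (x (k + 1) i)‖ ^ 2)
      ≤ (Real.sqrt δ * R + Real.sqrt (2 * δ) * ∑ j ∈ Finset.range (k + 1), T j * a j) ^ 2 := by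
  have hm0 : (m : ℝ) ≠ 0 := by positivity
  set xb : ℕ → E := fun k => (m : ℝ)⁻¹ • ∑ i, x k i with hxb
  set zb : ℕ → E := fun k => (m : ℝ)⁻¹ • ∑ i, z k i with hzb
  set v : ℕ → E := fun k => xb k + T k • (zb k - xb k) with hv
  have hv0 : v 0 = xb 0 := by simp [hv, hzb, hxb, hz0]
  have hv1 : ∀ k, v (k + 1) = xb k + T k • (xb (k + 1) - xb k) := by
    intro k
    have : T (k + 1) • (zb (k + 1) - xb (k + 1)) = (T k - 1) • (xb (k + 1) - xb k) := by
      simp only [hzb, hxb, ← smul_sub, ← Finset.sum_sub_distrib]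
      rw [smul_comm, smul_comm (T k - 1), Finset.smul_sum (r := T (k + 1)),
        Finset.smul_sum (r := T k - 1)]
      congr 1
      exact Finset.sum_congr rfl (fun i _ => hz k i)
    simp only [hv, this]; module
  have hpb : ∀ k y, u (p k) + δ / 2 * ‖p k - zb k‖ ^ 2 ≤ u y + δ / 2 * ‖y - zb k‖ ^ 2 :=
    fun k y => dc_xz hm (z k) (p k) (hp k) y
  set M : E → ℝ := fun y => u (prox y) + δ / 2 * ‖prox y - y‖ ^ 2 with hM
  set B : ℕ → ℝ := fun k => Real.sqrt δ * R + Real.sqrt (2 * δ) * ∑ j ∈ Finset.range k, T j * a j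
    with hB
  have hB0 : ∀ k, 0 ≤ B k := by
    intro k
    have : 0 ≤ ∑ j ∈ Finset.range k, T j * a j :=
      Finset.sum_nonneg (fun j _ => mul_nonneg (by linarith [hT1 j]) (ha j))
    positivity
  have hBs : ∀ k, B (k + 1) = B k + Real.sqrt (2 * δ) * (T k * a k) := by
    intro k; simp only [hB, Finset.sum_range_succ]; ring
  -- exact step given the potential bound
  have hstep : ∀ k, (T k ^ 2 - T k) * (M (xb k) - u xs) + δ / 2 * ‖v k - xs‖ ^ 2 ≤ B k ^ 2 →
      T k ^ 2 * (u (p k) - u xs) + δ / 2 * ‖xb k + T k • (p k - xb k) - xs‖ ^ 2 ≤ B k ^ 2 := by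
    intro k h
    refine le_trans ?_ h
    exact dc_step hconv hδ (hpb k) xs (xb k) (v k) (prox (xb k)) (T k) (hT1 k) (by simp [hv])
  have hD : ∀ k, 0 ≤ T k ^ 2 * (u (p k) - u xs) :=
    fun k => mul_nonneg (sq_nonneg _) (by linarith [hxs (p k)])
  have hpot : ∀ k, (T k ^ 2 - T k) * (M (xb k) - u xs) + δ / 2 * ‖v k - xs‖ ^ 2 ≤ B k ^ 2 := by
    intro k
    induction k with
    | zero =>
      rw [hT0, hv0]
      have h1 : M (xb 0) ≤ u xs + δ / 2 * ‖xs - xb 0‖ ^ 2 := hprox _ _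
      have h2 : ‖xb 0 - xs‖ ^ 2 ≤ R ^ 2 := by
        rw [hR2]
        simp_rw [norm_sub_rev xs]
        exact dc_avg_le hm (x 0) xs
      have h3 : B 0 ^ 2 = δ * R ^ 2 := by
        simp only [hB, Finset.range_zero, Finset.sum_empty, mul_zero, add_zero, mul_pow,
          Real.sq_sqrt hδ.le]
      rw [h3]
      rw [norm_sub_rev] at h1
      nlinarith
    | succ k ih =>
      have h1 := hstep k ih
      rw [hT, hBs, hv1]
      have hw : ‖xb (k + 1) - p k‖ ≤ a k := by
        apply le_of_sq_le_sq _ (ha k)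
        rw [ha2]
        exact dc_avg_le hm (x (k + 1)) (p k)
      have h2 := dc_inexact hδ (hB0 k) (norm_nonneg _) hw (by linarith [hT1 k] : 0 ≤ T k) (hD k)
        (norm_nonneg _) h1
      refine le_trans ?_ h2
      have h3 : M (xb (k + 1)) ≤ u (p k) + δ / 2 * ‖p k - xb (k + 1)‖ ^ 2 := hprox _ _
      rw [norm_sub_rev] at h3
      have h4 : ‖xb k + T k • (xb (k + 1) - xb k) - xs‖
          ≤ ‖xb k + T k • (p k - xb k) - xs‖ + T k * ‖xb (k + 1) - p k‖ := by
        have : xb k + T k • (xb (k + 1) - xb k) - xs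
          = (xb k + T k • (p k - xb k) - xs) + T k • (xb (k + 1) - p k) := by module
        rw [this]
        refine (norm_add_le _ _).trans ?_
        rw [norm_smul, Real.norm_eq_abs, abs_of_nonneg (by linarith [hT1 k])]
      have h5 := pow_le_pow_left₀ (norm_nonneg _) h4 2
      have h6 := mul_le_mul_of_nonneg_left h3 (sq_nonneg (T k))
      have h7 := mul_le_mul_of_nonneg_left h5 (by positivity : 0 ≤ δ / 2)
      linarith
  have h1 := hstep k (hpot k)
  have h2 := dc_inexact hδ (hB0 k) (ha k) le_rfl (by linarith [hT1 k] : 0 ≤ T k) (hD k)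
        (norm_nonneg _) h1
  rw [← hBs] at h2
  refine le_trans ?_ h2
  have h3 : ∀ i, δ / 2 * ‖x (k + 1) i - prox (x (k + 1) i)‖ ^ 2
      ≤ (u (p k) - u xs) + δ / 2 * ‖x (k + 1) i - p k‖ ^ 2 := by
    intro i
    have h := hprox (x (k + 1) i) (p k)
    rw [norm_sub_rev, norm_sub_rev (p k)] at h
    linarith [hxs (prox (x (k + 1) i))]
  have h4 := Finset.sum_le_sum (s := Finset.univ) (fun i _ => h3 i)
  rw [Finset.sum_add_distrib, ← Finset.mul_sum, ← Finset.mul_sum] at h4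
  simp only [Finset.sum_const, Finset.card_univ, Fintype.card_fin, nsmul_eq_mul] at h4
  have h5 : δ / (2 * m) * ∑ i, ‖x (k + 1) i - prox (x (k + 1) i)‖ ^ 2
      ≤ (u (p k) - u xs) + δ / 2 * a k ^ 2 := by
    rw [ha2]
    have hmp : 0 ≤ (m : ℝ)⁻¹ := by positivity
    have := mul_le_mul_of_nonneg_left h4 hmp
    calc _ = (m : ℝ)⁻¹ * (δ / 2 * ∑ i, ‖x (k + 1) i - prox (x (k + 1) i)‖ ^ 2) := by
          field_simp
      _ ≤ _ := this
      _ = _ := by field_simp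
  have h6 := mul_le_mul_of_nonneg_left h5 (sq_nonneg (T k))
  have h7 : 0 ≤ δ / 2 * (‖xb k + T k • (p k - xb k) - xs‖ + T k * a k) ^ 2 := by positivity
  linarith

end Helpers

/-- Weighted Cauchy-Schwarz. -/
lemma dc_cs (n : ℕ) (c : ℝ) (hc : 0 ≤ c) (w a s : ℕ → ℝ) (hw : ∀ j, 0 ≤ w j)
    (hs : ∀ j, 0 < s j) :
    (c + ∑ j ∈ Finset.range n, w j * a j) ^ 2
      ≤ (c + ∑ j ∈ Finset.range n, w j * s j) *
        (c + ∑ j ∈ Finset.range n, w j / s j * a j ^ 2) := by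
  induction n with
  | zero => simp [sq]
  | succ n ih =>
    rw [Finset.sum_range_succ, Finset.sum_range_succ, Finset.sum_range_succ, ← add_assoc,
      ← add_assoc, ← add_assoc]
    set X := c + ∑ j ∈ Finset.range n, w j * a j
    have hY : 0 ≤ c + ∑ j ∈ Finset.range n, w j * s j :=
      add_nonneg hc (Finset.sum_nonneg (fun j _ => mul_nonneg (hw j) (hs j).le))
    have hZ : 0 ≤ c + ∑ j ∈ Finset.range n, w j / s j * a j ^ 2 :=
      add_nonneg hc (Finset.sum_nonneg (fun j _ =>
        mul_nonneg (div_nonneg (hw j) (hs j).le) (sq_nonneg _)))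
    set Y := c + ∑ j ∈ Finset.range n, w j * s j
    set Z := c + ∑ j ∈ Finset.range n, w j / s j * a j ^ 2
    have hwn := hw n
    have hsn := hs n
    set r := a n / s n with hr
    have har : a n = r * s n := by rw [hr]; field_simp
    rw [har]
    have e : w n / s n * (r * s n) ^ 2 = w n * s n * r ^ 2 := by field_simp
    rw [e]
    have h2 : 2 * X * r ≤ Y * r ^ 2 + Z := by
      rcases hY.eq_or_lt with h0 | h0
      · rw [← h0] at ih ⊢
        have : X = 0 := by nlinarith
        rw [this]; linarith
      · have : 0 ≤ Y * (Y * r ^ 2 + Z - 2 * X * r) := by nlinarith [sq_nonneg (Y * r - X)]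
        have := nonneg_of_mul_nonneg_right this h0
        linarith
    have h3 := mul_le_mul_of_nonneg_left h2 (mul_nonneg hwn hsn.le)
    nlinarith

lemma dc_sum_bound (r : ℝ) (hr : 0 < r) (hr1 : r ≤ 1) (n : ℕ) :
    ∑ j ∈ Finset.range n, ((j : ℝ) + 3) ^ (-(1 + r)) ≤ 1 / r := by
  have key : ∀ n : ℕ, ∑ j ∈ Finset.range n, ((j : ℝ) + 3) ^ (-(1 + r))
      ≤ 1 / r - 1 / r * ((n : ℝ) + 2) ^ (-r) := by
    intro n
    induction n with
    | zero =>
      have : (2 : ℝ) ^ (-r) ≤ 1 := Real.rpow_le_one_of_one_le_of_nonpos (by norm_num) (by linarith)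
      have h : 0 < 1 / r := by positivity
      simp only [Finset.range_zero, Finset.sum_empty, Nat.cast_zero, zero_add]
      nlinarith
    | succ n ih =>
      rw [Finset.sum_range_succ]
      push_cast
      have hN : (n : ℝ) + 1 + 2 = n + 3 := by ring
      rw [hN]
      set N : ℝ := (n : ℝ) + 3 with hNd
      have hN3 : 3 ≤ N := by simp [hNd]
      have hN2 : (n : ℝ) + 2 = N * (1 + -(1 / N)) := by field_simp; ring
      have hlt : 1 / N < 1 := by rw [div_lt_one (by linarith)]; linarith
      have hb : (1 + -(1 / N)) ^ r ≤ 1 + r * -(1 / N) :=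
        rpow_one_add_le_one_add_mul_self (by linarith) hr.le hr1
      have hq : 0 < (1 + -(1 / N)) ^ r := Real.rpow_pos_of_pos (by linarith) _
      have hb2 : 1 + r / N ≤ (1 + -(1 / N)) ^ (-r) := by
        rw [Real.rpow_neg (by linarith), ← one_div, le_div_iff₀ hq]
        have : 0 ≤ r / N := by positivity
        have e : r * -(1 / N) = - (r / N) := by ring
        rw [e] at hb
        nlinarith
      have e1 : ((n : ℝ) + 2) ^ (-r) = N ^ (-r) * (1 + -(1 / N)) ^ (-r) := by
        rw [hN2, Real.mul_rpow (by linarith) (by linarith)]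
      have e2 : N ^ (-(1 + r)) = N ^ (-r) / N := by
        rw [show -(1 + r) = -r - 1 by ring, Real.rpow_sub_one (by linarith)]
      have hp : 0 < N ^ (-r) := Real.rpow_pos_of_pos (by linarith) _
      rw [e1] at ih
      rw [e2]
      have h1 := mul_le_mul_of_nonneg_left hb2 hp.le
      have h2 := mul_le_mul_of_nonneg_left h1 (by positivity : 0 ≤ 1 / r)
      have e3 : 1 / r * (N ^ (-r) * (1 + r / N)) = 1 / r * N ^ (-r) + N ^ (-r) / N := by
        field_simp
      rw [e3] at h2
      linarith
  refine (key n).trans ?_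
  have : 0 ≤ 1 / r * ((n : ℝ) + 2) ^ (-r) := by positivity
  linarith

lemma dc_const {δ ε r R C mm : ℝ} (hδ : 0 < δ) (hε : 0 < ε) (hr : 0 < r) (hR : 0 ≤ R)
    (hmm : 1 ≤ mm)
    (hC : C = Real.sqrt (250 * δ * mm * ε * (8 * δ * R ^ 2 + 9000 * δ * mm * ε * (1 + 1 / r) ^ 2))) :
    (Real.sqrt δ * R + Real.sqrt (2 * δ) * (Real.sqrt ε / r)) ^ 2 ≤ δ * R ^ 2 + 10 * C / r := by
  have hA : δ * R * Real.sqrt ε ≤ C := by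
    rw [hC]
    apply Real.le_sqrt_of_sq_le
    have e : (δ * R * Real.sqrt ε) ^ 2 = δ ^ 2 * R ^ 2 * ε := by
      rw [mul_pow, Real.sq_sqrt hε.le]; ring
    rw [e]
    have h1 : δ ^ 2 * R ^ 2 * ε * 1 ≤ δ ^ 2 * R ^ 2 * ε * (2000 * mm) :=
      mul_le_mul_of_nonneg_left (by linarith) (by positivity)
    have h2 : 0 ≤ 250 * δ * mm * ε * (9000 * δ * mm * ε * (1 + 1 / r) ^ 2) := by positivity
    nlinarith
  have hB : δ * ε / r ≤ C := by
    rw [hC]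
    apply Real.le_sqrt_of_sq_le
    have h1 : (δ * ε / r) ^ 2 ≤ (δ * mm * ε * (1 + 1 / r)) ^ 2 := by
      apply pow_le_pow_left₀ (by positivity)
      calc δ * ε / r = δ * 1 * ε * (1 / r) := by ring
        _ ≤ δ * mm * ε * (1 + 1 / r) := by gcongr; linarith
    have h2 : 0 ≤ 250 * δ * mm * ε * (8 * δ * R ^ 2) := by positivity
    have h3 : 0 ≤ (δ * mm * ε * (1 + 1 / r)) ^ 2 := by positivity
    nlinarith
  have hx : Real.sqrt (2 * δ) = Real.sqrt 2 * Real.sqrt δ := Real.sqrt_mul (by norm_num) _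
  have h2 : Real.sqrt 2 ≤ 2 := by
    rw [Real.sqrt_le_left (by norm_num)]; norm_num
  have e : (Real.sqrt δ * R + Real.sqrt (2 * δ) * (Real.sqrt ε / r)) ^ 2
      = δ * R ^ 2 + 2 * Real.sqrt 2 * (δ * R * Real.sqrt ε) / r + 2 * (δ * ε / r) / r := by
    rw [hx]
    have a1 : Real.sqrt δ ^ 2 = δ := Real.sq_sqrt hδ.le
    have a2 : Real.sqrt ε ^ 2 = ε := Real.sq_sqrt hε.le
    have a3 : Real.sqrt 2 ^ 2 = 2 := Real.sq_sqrt (by norm_num)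
    calc _ = Real.sqrt δ ^ 2 * R ^ 2 + 2 * Real.sqrt 2 * (Real.sqrt δ ^ 2 * R * Real.sqrt ε) / r
          + Real.sqrt 2 ^ 2 * (Real.sqrt δ ^ 2 * Real.sqrt ε ^ 2 / r) / r := by ring
      _ = _ := by rw [a1, a2, a3]
  rw [e]
  have h3 : 2 * Real.sqrt 2 * (δ * R * Real.sqrt ε) / r ≤ 4 * C / r := by
    gcongr
    linarith
  have h4 : 2 * (δ * ε / r) / r ≤ 2 * C / r := by gcongr
  have h5 : 0 ≤ C / r := div_nonneg (by rw [hC]; exact Real.sqrt_nonneg _) hr.le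
  have e1 : 4 * C / r = 4 * (C / r) := by ring
  have e2 : 2 * C / r = 2 * (C / r) := by ring
  have e3 : 10 * C / r = 10 * (C / r) := by ring
  linarith

lemma dc_T (α : ℕ → ℝ) (hα0 : α 0 = (Real.sqrt 5 - 1) / 2)
    (hαmem : ∀ k, α (k + 1) ∈ Set.Ioo (0 : ℝ) 1)
    (hαrec : ∀ k, (α (k + 1)) ^ 2 = (1 - α (k + 1)) * (α k) ^ 2) :
    (∀ k, 0 < α k) ∧ (∀ k, 1 ≤ (α k)⁻¹) ∧ ((α 0)⁻¹ ^ 2 - (α 0)⁻¹ = 1) ∧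
    (∀ k, (α (k + 1))⁻¹ ^ 2 - (α (k + 1))⁻¹ = (α k)⁻¹ ^ 2) ∧
    (∀ k : ℕ, ((k : ℝ) + 3) / 2 ≤ (α k)⁻¹) ∧ (∀ k : ℕ, (α k)⁻¹ ≤ (k : ℝ) + 2) := by
  have h5 : Real.sqrt 5 ^ 2 = 5 := Real.sq_sqrt (by norm_num)
  have h50 : 0 ≤ Real.sqrt 5 := Real.sqrt_nonneg _
  have h51 : 2 < Real.sqrt 5 := by nlinarith
  have h52 : Real.sqrt 5 < 3 := by nlinarith
  have hpos : ∀ k, 0 < α k := by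
    intro k
    cases k with
    | zero => rw [hα0]; linarith
    | succ k => exact (hαmem k).1
  have hle : ∀ k, α k ≤ 1 := by
    intro k
    cases k with
    | zero => rw [hα0]; linarith
    | succ k => exact (hαmem k).2.le
  have h1 : ∀ k, 1 ≤ (α k)⁻¹ := fun k => (one_le_inv₀ (hpos k)).2 (hle k)
  have hT0 : (α 0)⁻¹ = (Real.sqrt 5 + 1) / 2 := by
    rw [hα0, inv_eq_iff_eq_inv, eq_comm, inv_eq_iff_eq_inv, eq_comm]
    symm
    apply eq_inv_of_mul_eq_one_left
    nlinarith
  have hrec : ∀ k, (α (k + 1))⁻¹ ^ 2 - (α (k + 1))⁻¹ = (α k)⁻¹ ^ 2 := by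
    intro k
    have a := hpos k
    have b := hpos (k + 1)
    have := hαrec k
    field_simp
    linarith
  refine ⟨hpos, h1, ?_, hrec, ?_, ?_⟩
  · rw [hT0]; nlinarith
  · intro k
    induction k with
    | zero => rw [hT0]; norm_num; linarith
    | succ k ih =>
      have := hrec k
      have := h1 (k + 1)
      have hk : (0 : ℝ) ≤ k := Nat.cast_nonneg k
      push_cast
      by_contra! hcon
      nlinarith
  · intro k
    induction k with
    | zero => rw [hT0]; norm_num; linarith
    | succ k ih =>
      have := hrec k
      have := h1 (k + 1)
      have := h1 k
      push_cast
      by_contra! hcon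
      nlinarith

/-- **Convergence of the DCatalyst outer loop for (non-strongly) convex objectives**
(Proposition 3). With the Nesterov coefficients `α^0 = (√5−1)/2`,
`(α^{k})² = (1−α^{k})(α^{k−1})²` and `α^k ∈ (0,1)`, a convex `u` minimized at `x⋆`, the
proximal-subproblem minimizers `x⋆_z` of `u_z(x) := u(x) + (δ/(2m))∑_i ‖x−z_i‖²`, and the
proximal map `prox = prox_{(1/δ)u}`, assume the deterministic consensus-bounded
initialization (a), the extrapolation step (b), and the inexactness bound (c):
`(1/m)∑_i E[‖x_i^{k+1}−x⋆_{z^k}‖²] ≤ ε₀/(k+3)^{4+2r₀}`. Then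
`(δ/(2m))∑_i E[‖x_i^k−prox(x_i^k)‖²] ≤ c_cvx/(k+2)²` with the explicit constant `c_cvx`;
moreover, if `u` is differentiable with an `L`-Lipschitz gradient, then
`(1/(2δm))∑_i E[‖∇u(x_i^k)‖²] ≤ c_cvx(L+δ)²/(δ²(k+2)²)`. -/
theorem dcatalyst_outer_loop_convex
    (d m : ℕ) (hd : 1 ≤ d) (hm : 1 ≤ m)
    (δ ε₀ r₀ : ℝ) (hδ : 0 < δ) (hε₀ : 0 < ε₀) (hr₀ : r₀ ∈ Set.Ioc (0 : ℝ) 1)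
    (α : ℕ → ℝ) (hα0 : α 0 = (Real.sqrt 5 - 1) / 2)
    (hαmem : ∀ k, α (k + 1) ∈ Set.Ioo (0 : ℝ) 1)
    (hαrec : ∀ k, (α (k + 1)) ^ 2 = (1 - α (k + 1)) * (α k) ^ 2)
    (u : EuclideanSpace ℝ (Fin d) → ℝ)
    (hconv : ConvexOn ℝ Set.univ u)
    (xstar : EuclideanSpace ℝ (Fin d)) (hxstar : ∀ x, u xstar ≤ u x)
    -- the proximal map `prox_{(1/δ) u}`
    (prox : EuclideanSpace ℝ (Fin d) → EuclideanSpace ℝ (Fin d))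
    (hprox : ∀ x y, u (prox x) + δ / 2 * ‖prox x - x‖ ^ 2
      ≤ u y + δ / 2 * ‖y - x‖ ^ 2)
    -- the (unique) minimizer of the proximal subproblem `u_z`
    (xz : (Fin m → EuclideanSpace ℝ (Fin d)) → EuclideanSpace ℝ (Fin d))
    (hxz : ∀ (zz : Fin m → EuclideanSpace ℝ (Fin d)) (y : EuclideanSpace ℝ (Fin d)),
      u (xz zz) + δ / (2 * m) * ∑ i, ‖xz zz - zz i‖ ^ 2
        ≤ u y + δ / (2 * m) * ∑ i, ‖y - zz i‖ ^ 2)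
    -- probability space and random sequences
    {Ω : Type*} [MeasurableSpace Ω] (P : Measure Ω) [IsProbabilityMeasure P]
    (x z : ℕ → Fin m → Ω → EuclideanSpace ℝ (Fin d))
    (hint₁ : ∀ k i, Integrable (fun ω => ‖x k i ω - prox (x k i ω)‖ ^ 2) P)
    (hint₂ : ∀ k i,
      Integrable (fun ω => ‖x (k + 1) i ω - xz (fun j => z k j ω)‖ ^ 2) P)
    -- (a) deterministic initialization, consensus error at most ε₀
    (x0 : Fin m → EuclideanSpace ℝ (Fin d))
    (hx0 : ∀ i ω, x 0 i ω = x0 i) (hz0 : ∀ i ω, z 0 i ω = x0 i)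
    (hx0cons : 1 / (m : ℝ) * ∑ i, ‖x0 i - (m : ℝ)⁻¹ • ∑ j, x0 j‖ ^ 2 ≤ ε₀)
    -- (b) extrapolation step
    (hextra : ∀ i k, ∀ᵐ ω ∂P,
      z (k + 1) i ω = x (k + 1) i ω
        + (α k * (1 - α k) / ((α k) ^ 2 + α (k + 1))) • (x (k + 1) i ω - x k i ω))
    -- (c) inexactness of the inner loop
    (hinexact : ∀ k : ℕ,
      1 / (m : ℝ) * ∑ i, ∫ ω, ‖x (k + 1) i ω - xz (fun j => z k j ω)‖ ^ 2 ∂P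
        ≤ ε₀ / ((k : ℝ) + 3) ^ ((4 : ℝ) + 2 * r₀))
    -- the constants of the statement
    (cv Ccvx ccvx : ℝ)
    (hcv : cv = 1 / (m : ℝ)
      * ∑ i, (8 * δ * ‖xstar - x0 i‖ ^ 2 + 9000 * δ * m * ε₀ * (1 + 1 / r₀) ^ 2))
    (hCcvx : Ccvx = Real.sqrt (250 * δ * m * ε₀ * cv))
    (hccvx : ccvx = 4 / (m : ℝ)
      * ∑ i, (δ * ‖xstar - x0 i‖ ^ 2 + 10 * Ccvx / r₀)) :
    (∀ k : ℕ,
      δ / (2 * (m : ℝ)) * ∑ i, ∫ ω, ‖x k i ω - prox (x k i ω)‖ ^ 2 ∂P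
        ≤ ccvx / ((k : ℝ) + 2) ^ 2)
    ∧ (∀ (L : ℝ) (u' : EuclideanSpace ℝ (Fin d) → EuclideanSpace ℝ (Fin d)),
        (∀ y, HasGradientAt u (u' y) y) →
        (∀ y w, ‖u' y - u' w‖ ≤ L * ‖y - w‖) →
        (∀ k i, Integrable (fun ω => ‖u' (x k i ω)‖ ^ 2) P) →
        ∀ k : ℕ,
          1 / (2 * δ * (m : ℝ)) * ∑ i, ∫ ω, ‖u' (x k i ω)‖ ^ 2 ∂P
            ≤ ccvx * (L + δ) ^ 2 / (δ ^ 2 * ((k : ℝ) + 2) ^ 2)) := by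
  obtain ⟨hαpos, hT1, hT0, hTrec, hTlow, hTup⟩ := dc_T α hα0 hαmem hαrec
  obtain ⟨hr, hr1⟩ := hr₀
  have hm0 : (0 : ℝ) < m := by exact_mod_cast hm
  set R : ℝ := Real.sqrt (1 / (m : ℝ) * ∑ i, ‖xstar - x0 i‖ ^ 2) with hRdef
  have hR : 0 ≤ R := Real.sqrt_nonneg _
  have hR2 : R ^ 2 = 1 / (m : ℝ) * ∑ i, ‖xstar - x0 i‖ ^ 2 := Real.sq_sqrt (by positivity)
  have hcv2 : cv = 8 * δ * R ^ 2 + 9000 * δ * m * ε₀ * (1 + 1 / r₀) ^ 2 := by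
    rw [hcv, hR2, Finset.sum_add_distrib, ← Finset.mul_sum]
    simp only [Finset.sum_const, Finset.card_univ, Fintype.card_fin, nsmul_eq_mul]
    field_simp
  have hcc2 : ccvx = 4 * (δ * R ^ 2 + 10 * Ccvx / r₀) := by
    rw [hccvx, hR2, Finset.sum_add_distrib, ← Finset.mul_sum]
    simp only [Finset.sum_const, Finset.card_univ, Fintype.card_fin, nsmul_eq_mul]
    field_simp
  have hC0 : 0 ≤ Ccvx := by rw [hCcvx]; exact Real.sqrt_nonneg _
  have hconst := dc_const (C := Ccvx) (mm := m) hδ hε₀ hr hR (by exact_mod_cast hm)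
    (by rw [hCcvx, hcv2])
  have main : ∀ k : ℕ,
      δ / (2 * (m : ℝ)) * ∑ i, ∫ ω, ‖x k i ω - prox (x k i ω)‖ ^ 2 ∂P
        ≤ ccvx / ((k : ℝ) + 2) ^ 2 := by
    intro k
    cases k with
    | zero =>
      have h1 : ∀ i, ∫ ω, ‖x 0 i ω - prox (x 0 i ω)‖ ^ 2 ∂P ≤ 2 * ‖xstar - x0 i‖ ^ 2 := by
        intro i
        simp only [hx0, integral_const, probReal_univ, one_smul]
        have h := hprox (x0 i) xstar
        have h' := hxstar (prox (x0 i))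
        rw [norm_sub_rev (prox _)] at h
        have h2 : δ / 2 * ‖x0 i - prox (x0 i)‖ ^ 2 ≤ δ / 2 * ‖xstar - x0 i‖ ^ 2 := by linarith
        have h3 := le_of_mul_le_mul_left h2 (by positivity)
        have : 0 ≤ ‖xstar - x0 i‖ ^ 2 := by positivity
        linarith
      have h2 := Finset.sum_le_sum (s := Finset.univ) (fun i _ => h1 i)
      rw [← Finset.mul_sum] at h2
      have h3 := mul_le_mul_of_nonneg_left h2 (by positivity : 0 ≤ δ / (2 * (m : ℝ)))
      refine h3.trans ?_
      have e : δ / (2 * (m : ℝ)) * (2 * ∑ i, ‖xstar - x0 i‖ ^ 2) = δ * R ^ 2 := by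
        rw [hR2]; field_simp
      rw [e, hcc2]
      have : 0 ≤ 10 * Ccvx / r₀ := by positivity
      norm_num
      linarith
    | succ k =>
      set a : ℕ → Ω → ℝ := fun j ω =>
        Real.sqrt (1 / (m : ℝ) * ∑ i, ‖x (j + 1) i ω - xz (fun l => z j l ω)‖ ^ 2) with ha
      have ha2 : ∀ j ω, a j ω ^ 2
          = 1 / (m : ℝ) * ∑ i, ‖x (j + 1) i ω - xz (fun l => z j l ω)‖ ^ 2 :=
        fun j ω => Real.sq_sqrt (by positivity)
      have haint : ∀ j, Integrable (fun ω => a j ω ^ 2) P := by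
        intro j
        simp only [ha2]
        exact (integrable_finsetSum _ (fun i _ => hint₂ j i)).const_mul _
      set s : ℕ → ℝ := fun j => Real.sqrt ε₀ * ((j : ℝ) + 3) ^ (-(2 + r₀)) with hs
      have hspos : ∀ j, 0 < s j := by
        intro j
        have : 0 < Real.sqrt ε₀ := Real.sqrt_pos.2 hε₀
        simp only [hs]; positivity
      have haexp : ∀ j, ∫ ω, a j ω ^ 2 ∂P ≤ s j ^ 2 := by
        intro j
        simp only [ha2]
        rw [integral_const_mul, integral_finsetSum _ (fun i _ => hint₂ j i)]
        refine (hinexact j).trans (le_of_eq ?_)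
        have hj : (0 : ℝ) ≤ (j : ℝ) + 3 := by positivity
        simp only [hs]
        rw [mul_pow, Real.sq_sqrt hε₀.le, ← Real.rpow_natCast (_ ^ _) 2, ← Real.rpow_mul hj,
          div_eq_mul_inv, ← Real.rpow_neg hj]
        congr 2
        push_cast; ring
      set w : ℕ → ℝ := fun j => Real.sqrt (2 * δ) * (α j)⁻¹ with hw
      have hw0 : ∀ j, 0 ≤ w j := by
        intro j
        have := hT1 j
        simp only [hw]; positivity
      set c : ℝ := Real.sqrt δ * R with hc
      have hc0 : 0 ≤ c := by positivity
      set Y : ℝ := c + ∑ j ∈ Finset.range (k + 1), w j * s j with hY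
      have hY0 : 0 ≤ Y :=
        add_nonneg hc0 (Finset.sum_nonneg (fun j _ => mul_nonneg (hw0 j) (hspos j).le))
      have hYle : Y ≤ Real.sqrt δ * R + Real.sqrt (2 * δ) * (Real.sqrt ε₀ / r₀) := by
        have h1 : ∑ j ∈ Finset.range (k + 1), w j * s j
            ≤ ∑ j ∈ Finset.range (k + 1),
              Real.sqrt (2 * δ) * (Real.sqrt ε₀ * ((j : ℝ) + 3) ^ (-(1 + r₀))) := by
          apply Finset.sum_le_sum
          intro j _
          simp only [hw, hs]
          have hj : (0 : ℝ) < (j : ℝ) + 3 := by positivity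
          have e : ((j : ℝ) + 3) ^ (-(1 + r₀)) = ((j : ℝ) + 3) ^ (-(2 + r₀)) * ((j : ℝ) + 3) := by
            rw [← Real.rpow_add_one hj.ne']; congr 1; ring
          rw [e]
          have h := hTup j
          calc _ = Real.sqrt (2 * δ) * (Real.sqrt ε₀ * (((j : ℝ) + 3) ^ (-(2 + r₀)) * (α j)⁻¹)) := by
                ring
            _ ≤ _ := by gcongr; linarith
        rw [← Finset.mul_sum, ← Finset.mul_sum] at h1
        have h2 := dc_sum_bound r₀ hr hr1 (k + 1)
        have h3 : Real.sqrt (2 * δ) * (Real.sqrt ε₀ *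
            ∑ j ∈ Finset.range (k + 1), ((j : ℝ) + 3) ^ (-(1 + r₀)))
            ≤ Real.sqrt (2 * δ) * (Real.sqrt ε₀ * (1 / r₀)) := by gcongr
        rw [mul_one_div] at h3
        simp only [hY, hc]
        linarith
      have hae : ∀ᵐ ω ∂P, (α k)⁻¹ ^ 2 *
          (δ / (2 * m) * ∑ i, ‖x (k + 1) i ω - prox (x (k + 1) i ω)‖ ^ 2)
          ≤ Y * (c + ∑ j ∈ Finset.range (k + 1), w j / s j * a j ω ^ 2) := by
        have hall : ∀ᵐ ω ∂P, ∀ i k, z (k + 1) i ω = x (k + 1) i ω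
            + (α k * (1 - α k) / ((α k) ^ 2 + α (k + 1))) • (x (k + 1) i ω - x k i ω) :=
          ae_all_iff.2 (fun i => ae_all_iff.2 (fun k => hextra i k))
        filter_upwards [hall] with ω hω
        have h1 := dc_pathwise hm hconv hδ xstar hxstar prox hprox (fun k => (α k)⁻¹) hT1 hT0 hTrec
          (fun k i => x k i ω) (fun k i => z k i ω) (fun k => xz (fun l => z k l ω))
          (fun k y => hxz _ y) (fun i => by rw [hz0, hx0])
          (by
            intro k i
            rw [hω i k, add_sub_cancel_left, smul_smul]
            congr 1
            have h0 := hαpos k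
            have h1 := hαpos (k + 1)
            have h2 := hαrec k
            have e : (α k) ^ 2 + α (k + 1) = (α k) ^ 2 / α (k + 1) := by
              field_simp; nlinarith
            rw [e]; field_simp)
          (fun j => a j ω) (fun j => Real.sqrt_nonneg _) (fun j => ha2 j ω) R hR
          (by simp only [hx0]; exact hR2) k
        refine h1.trans ?_
        have h2 := dc_cs (k + 1) c hc0 w (fun j => a j ω) s hw0 hspos
        refine le_trans (le_of_eq ?_) h2
        simp only [hw, hc, Finset.mul_sum, mul_assoc]
      have hint := integral_mono_ae
        (((integrable_finsetSum _ (fun i _ => hint₁ (k + 1) i)).const_mul _).const_mul _)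
        (((integrable_const c).add (integrable_finsetSum _ (fun j _ =>
          (haint j).const_mul (w j / s j)))).const_mul Y) hae
      simp only [Pi.add_apply] at hint
      rw [integral_const_mul, integral_const_mul, integral_const_mul,
        integral_finsetSum _ (fun i _ => hint₁ (k + 1) i),
        integral_add (integrable_const c) (integrable_finsetSum _ (fun j _ =>
          (haint j).const_mul (w j / s j))),
        integral_finsetSum _ (fun j _ => (haint j).const_mul (w j / s j))] at hint
      simp only [integral_const_mul, integral_const, probReal_univ, one_smul] at hint
      have hYY : c + ∑ j ∈ Finset.range (k + 1), w j / s j * ∫ ω, a j ω ^ 2 ∂P ≤ Y := by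
        refine add_le_add le_rfl (Finset.sum_le_sum (fun j _ => ?_))
        have h1 := mul_le_mul_of_nonneg_left (haexp j) (div_nonneg (hw0 j) (hspos j).le)
        refine h1.trans (le_of_eq ?_)
        have := (hspos j).ne'
        field_simp
      have h1 := hint.trans (mul_le_mul_of_nonneg_left hYY hY0)
      have h2 : Y * Y ≤ ccvx / 4 := by
        rw [← sq, hcc2]
        have := pow_le_pow_left₀ hY0 hYle 2
        linarith
      have h3 : (((k : ℝ) + 3) / 2) ^ 2 ≤ (α k)⁻¹ ^ 2 :=
        pow_le_pow_left₀ (by positivity) (hTlow k) 2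
      set Q := δ / (2 * (m : ℝ)) * ∑ i, ∫ ω, ‖x (k + 1) i ω - prox (x (k + 1) i ω)‖ ^ 2 ∂P with hQ
      have hQ0 : 0 ≤ Q := mul_nonneg (by positivity)
        (Finset.sum_nonneg (fun i _ => integral_nonneg (fun ω => by positivity)))
      have h4 := mul_le_mul_of_nonneg_right h3 hQ0
      have e : ((k + 1 : ℕ) : ℝ) + 2 = (k : ℝ) + 3 := by push_cast; ring
      rw [e, le_div_iff₀ (by positivity)]
      nlinarith
  refine ⟨main, ?_⟩
  intro L u' hgrad hLip hint3 k
  have hopt : ∀ y, u' (prox y) = δ • (y - prox y) := by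
    intro y
    have hmin : IsLocalMin (fun w => u w - inner ℝ (δ • (y - prox y)) w) (prox y) := by
      refine Filter.Eventually.of_forall (fun w => ?_)
      have h := dc_subgrad hconv hδ (hprox y) w
      simp only [inner_smul_left, conj_trivial]
      rw [inner_sub_right] at h
      linarith
    have hd1 : HasFDerivAt (fun w => u w - inner ℝ (δ • (y - prox y)) w)
        (innerSL ℝ (u' (prox y)) - innerSL ℝ (δ • (y - prox y))) (prox y) := by
      have h1 := (hgrad (prox y)).hasFDerivAt
      exact h1.sub (innerSL ℝ (δ • (y - prox y))).hasFDerivAt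
    have h0 := hmin.hasFDerivAt_eq_zero hd1
    rw [← map_sub] at h0
    have h1 := congrArg (fun f => f (u' (prox y) - δ • (y - prox y))) h0
    simp only [innerSL_apply_apply, ContinuousLinearMap.zero_apply, inner_self_eq_zero] at h1
    exact sub_eq_zero.1 h1
  have hbound : ∀ y, ‖u' y‖ ^ 2 ≤ (L + δ) ^ 2 * ‖y - prox y‖ ^ 2 := by
    intro y
    have h1 : ‖u' y‖ ≤ (L + δ) * ‖y - prox y‖ := by
      calc ‖u' y‖ = ‖(u' y - u' (prox y)) + u' (prox y)‖ := by rw [sub_add_cancel]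
        _ ≤ ‖u' y - u' (prox y)‖ + ‖u' (prox y)‖ := norm_add_le _ _
        _ ≤ L * ‖y - prox y‖ + δ * ‖y - prox y‖ := by
          refine add_le_add (hLip _ _) (le_of_eq ?_)
          rw [hopt, norm_smul, Real.norm_eq_abs, abs_of_pos hδ]
        _ = _ := by ring
    rw [← mul_pow]
    exact pow_le_pow_left₀ (norm_nonneg _) h1 2
  have h1 : ∑ i, ∫ ω, ‖u' (x k i ω)‖ ^ 2 ∂P
      ≤ (L + δ) ^ 2 * ∑ i, ∫ ω, ‖x k i ω - prox (x k i ω)‖ ^ 2 ∂P := by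
    rw [Finset.mul_sum]
    apply Finset.sum_le_sum
    intro i _
    rw [← integral_const_mul]
    exact integral_mono (hint3 k i) ((hint₁ k i).const_mul _) (fun ω => hbound _)
  have h2 := mul_le_mul_of_nonneg_left h1 (by positivity : 0 ≤ 1 / (2 * δ * (m : ℝ)))
  refine h2.trans ?_
  have h3 := mul_le_mul_of_nonneg_left (main k)
    (by positivity : 0 ≤ (L + δ) ^ 2 / δ ^ 2)
  calc _ = (L + δ) ^ 2 / δ ^ 2 *
        (δ / (2 * (m : ℝ)) * ∑ i, ∫ ω, ‖x k i ω - prox (x k i ω)‖ ^ 2 ∂P) := by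
        field_simp
    _ ≤ _ := h3
    _ = _ := by field_simp
end

section
/- Telescoping bound for inexact estimating sequences (Lemma 6). Let d ≥ 1, let M : ℝ^d → ℝ and x⋆ ∈ ℝ^d satisfy M(x⋆) ≤ M(x) for all x ∈ ℝ^d, and let α^k ∈ (0,1) for all k ≥ 0. Suppose functions ψ^k : ℝ^d → ℝ and reals ε^k form an inexact estimating sequence, i.e. ψ^{k+1}(x⋆) ≤ (1−α^k)ψ^k(x⋆) + α^k(M(x⋆) + ε^k) for all k ≥ 0. Suppose further there are points x̃^k ∈ ℝ^d and reals ψ^{k,⋆}, ε_ψ^k with ε_ψ^0 = 0, such that ψ^{k,⋆} ≤ ψ^k(x) for all x ∈ ℝ^d and M(x̃^k) ≤ ψ^{k,⋆} + ε_ψ^k for all k ≥ 0. Then, with λ^k := ∏_{t=0}^{k−1}(1−α^t) (λ^0 := 1) and ε_tot^k := ε_ψ^{k+1} − (1−α^k)ε_ψ^k + α^k ε^k, for every k ≥ 0: 0 ≤ ψ^k(x⋆) + ε_ψ^k − M(x⋆) ≤ λ^k·(ψ^0(x⋆) − M(x⋆) + ∑_{t=0}^{k−1} ε_tot^t / λ^{t+1}).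 -/
open Finset

/-- **Telescoping bound for inexact estimating sequences** (Lemma 6).
If `(ψ^k, α^k, ε^k)` is an inexact estimating sequence relative to a function `M`
minimized at `x⋆`, and points `x̃^k` together with lower bounds `ψ^{k,⋆}` and errors
`ε_ψ^k` (with `ε_ψ^0 = 0`) satisfy `ψ^{k,⋆} ≤ ψ^k(x)` for all `x` and
`M(x̃^k) ≤ ψ^{k,⋆} + ε_ψ^k`, then with `λ^k := ∏_{t<k}(1−α^t)` and
`ε_tot^k := ε_ψ^{k+1} − (1−α^k)ε_ψ^k + α^k ε^k` one has
`0 ≤ ψ^k(x⋆) + ε_ψ^k − M(x⋆) ≤ λ^k (ψ^0(x⋆) − M(x⋆) + ∑_{t<k} ε_tot^t / λ^{t+1})`. -/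
theorem inexact_estimating_sequence_telescope
    (d : ℕ) (hd : 1 ≤ d)
    (M : EuclideanSpace ℝ (Fin d) → ℝ) (xstar : EuclideanSpace ℝ (Fin d))
    (hmin : ∀ x, M xstar ≤ M x)
    (α : ℕ → ℝ) (hα : ∀ k, α k ∈ Set.Ioo (0 : ℝ) 1)
    (ψ : ℕ → EuclideanSpace ℝ (Fin d) → ℝ) (ε : ℕ → ℝ)
    (hES : ∀ k, ψ (k + 1) xstar ≤ (1 - α k) * ψ k xstar + α k * (M xstar + ε k))
    (xt : ℕ → EuclideanSpace ℝ (Fin d)) (ψs εψ : ℕ → ℝ)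
    (hεψ0 : εψ 0 = 0)
    (hlow : ∀ k x, ψs k ≤ ψ k x)
    (hup : ∀ k, M (xt k) ≤ ψs k + εψ k) :
    ∀ k, 0 ≤ ψ k xstar + εψ k - M xstar ∧
      ψ k xstar + εψ k - M xstar
        ≤ (∏ t ∈ range k, (1 - α t)) *
          (ψ 0 xstar - M xstar
            + ∑ t ∈ range k,
                (εψ (t + 1) - (1 - α t) * εψ t + α t * ε t)
                  / ∏ s ∈ range (t + 1), (1 - α s)) := by
  intro k
  refine ⟨by linarith [hmin (xt k), hup k, hlow k xstar], ?_⟩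
  induction k with
  | zero => simp [hεψ0]
  | succ k ih =>
    have hpos : 0 < 1 - α k := by linarith [(hα k).2]
    have hP : 0 < ∏ t ∈ range (k + 1), (1 - α t) :=
      Finset.prod_pos fun t _ => by linarith [(hα t).2]
    rw [Finset.sum_range_succ, ← add_assoc, mul_add, mul_div_cancel₀ _ hP.ne',
      Finset.prod_range_succ]
    have h := mul_le_mul_of_nonneg_left ih hpos.le
    rw [← mul_assoc, mul_comm (1 - α k) (∏ t ∈ range k, (1 - α t))] at h
    linarith [hES k]
end

section
/- Linear convergence from inexact estimating sequences with geometrically decaying errors (Proposition 5(i)). Let d, m ≥ 1, let M : ℝ^d → ℝ, x⋆ ∈ ℝ^d and μ_M > 0 satisfy (μ_M/2)‖x−x⋆‖² ≤ M(x) − M(x⋆) for all x ∈ ℝ^d, and let α, c ∈ (0,1), C ≥ 0. On a probability space, for each i ∈ {1,…,m} let ψ_i^k (random functions ℝ^d → ℝ), ε_i^k, ψ_i^{k,⋆}, ε_{ψ,i}^k (random reals) and x̃_i^k (random vectors in ℝ^d) satisfy, almost surely for all i, k ≥ 0: ψ_i^{k+1}(x⋆) ≤ (1−α)ψ_i^k(x⋆)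 + α(M(x⋆)+ε_i^k); ψ_i^{k,⋆} ≤ ψ_i^k(x) for all x; M(x̃_i^k) ≤ ψ_i^{k,⋆} + ε_{ψ,i}^k; ε_{ψ,i}^0 = 0; each ψ_i^0(x⋆) is a deterministic real. Assume all these quantities are integrable and that (1/m)∑_{i=1}^m E[|ε_{tot,i}^k|] ≤ C(1−cα)^k for all k ≥ 0, where ε_{tot,i}^k := ε_{ψ,i}^{k+1} − (1−α)ε_{ψ,i}^k + α·ε_i^k. Then for every k ≥ 0: (1/m)∑_{i=1}^m E[‖x̃_i^k − x⋆‖²] ≤ (1−cα)^k · (1/m)∑_{i=1}^m (2/μ_M)(ψ_i^0(x⋆) − M(x⋆) + C/(α(1−c))). -/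
open MeasureTheory

/-- **Linear convergence from inexact estimating sequences with geometrically decaying
errors** (Proposition 5(i)). Let `M` satisfy the quadratic growth bound
`(μ_M/2)‖x−x⋆‖² ≤ M(x)−M(x⋆)` and let, for each agent `i`, the random inexact estimating
sequences `ψ_i^k` (with deterministic `ψ_i^0(x⋆)`), errors `ε_i^k`, lower bounds
`ψ_i^{k,⋆}`, inexactness terms `ε_{ψ,i}^k` (vanishing at `k = 0`) and iterates `x̃_i^k`
satisfy, almost surely, the estimating-sequence inequality, the lower-bound property and
`M(x̃_i^k) ≤ ψ_i^{k,⋆} + ε_{ψ,i}^k`. If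
`(1/m)∑_i E[|ε_{tot,i}^k|] ≤ C(1−cα)^k` for all `k`, then
`(1/m)∑_i E[‖x̃_i^k−x⋆‖²] ≤ (1−cα)^k (1/m)∑_i (2/μ_M)(ψ_i^0(x⋆)−M(x⋆)+C/(α(1−c)))`. -/
theorem inexact_estimating_sequences_linear_rate
    (d m : ℕ) (hd : 1 ≤ d) (hm : 1 ≤ m)
    (μM : ℝ) (hμM : 0 < μM)
    (M : EuclideanSpace ℝ (Fin d) → ℝ) (xstar : EuclideanSpace ℝ (Fin d))
    (hgrowth : ∀ x, μM / 2 * ‖x - xstar‖ ^ 2 ≤ M x - M xstar)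
    (α c : ℝ) (hα : α ∈ Set.Ioo (0 : ℝ) 1) (hc : c ∈ Set.Ioo (0 : ℝ) 1)
    (C : ℝ) (hC : 0 ≤ C)
    {Ω : Type*} [MeasurableSpace Ω] (P : Measure Ω) [IsProbabilityMeasure P]
    (ψ : ℕ → Fin m → Ω → EuclideanSpace ℝ (Fin d) → ℝ)
    (ε ψs εψ : ℕ → Fin m → Ω → ℝ)
    (xt : ℕ → Fin m → Ω → EuclideanSpace ℝ (Fin d))
    -- almost-sure structural properties
    (has : ∀ᵐ ω ∂P, ∀ (i : Fin m) (k : ℕ),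
      (ψ (k + 1) i ω xstar
          ≤ (1 - α) * ψ k i ω xstar + α * (M xstar + ε k i ω))
      ∧ (∀ x, ψs k i ω ≤ ψ k i ω x)
      ∧ (M (xt k i ω) ≤ ψs k i ω + εψ k i ω)
      ∧ εψ 0 i ω = 0)
    -- `ψ_i^0(x⋆)` is deterministic
    (ψ0 : Fin m → ℝ) (hψ0 : ∀ i ω, ψ 0 i ω xstar = ψ0 i)
    -- integrability of all the involved quantities
    (hint_ψ : ∀ k i, Integrable (fun ω => ψ k i ω xstar) P)
    (hint_ε : ∀ k i, Integrable (fun ω => ε k i ω) P)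
    (hint_ψs : ∀ k i, Integrable (fun ω => ψs k i ω) P)
    (hint_εψ : ∀ k i, Integrable (fun ω => εψ k i ω) P)
    (hint_xt : ∀ k i, Integrable (fun ω => ‖xt k i ω - xstar‖ ^ 2) P)
    -- geometric decay of the total errors
    (herr : ∀ k : ℕ,
      1 / (m : ℝ) * ∑ i, ∫ ω,
          |εψ (k + 1) i ω - (1 - α) * εψ k i ω + α * ε k i ω| ∂P
        ≤ C * (1 - c * α) ^ k) :
    ∀ k : ℕ,
      1 / (m : ℝ) * ∑ i, ∫ ω, ‖xt k i ω - xstar‖ ^ 2 ∂P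
        ≤ (1 - c * α) ^ k
          * (1 / (m : ℝ) * ∑ i, 2 / μM * (ψ0 i - M xstar + C / (α * (1 - c)))) := by
  obtain ⟨hα0, hα1⟩ := hα
  obtain ⟨hc0, hc1⟩ := hc
  have hm0 : (0 : ℝ) < m := by exact_mod_cast hm
  have hδ : 0 < α * (1 - c) := mul_pos hα0 (by linarith)
  have hq : 0 < 1 - c * α := by nlinarith
  have hY : ∀ k i, Integrable (fun ω => ψ k i ω xstar + εψ k i ω - M xstar) P := fun k i =>
    ((hint_ψ k i).add (hint_εψ k i)).sub (integrable_const _)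
  have hT : ∀ k i, Integrable
      (fun ω => |εψ (k + 1) i ω - (1 - α) * εψ k i ω + α * ε k i ω|) P := fun k i =>
    (((hint_εψ (k + 1) i).sub ((hint_εψ k i).const_mul (1 - α))).add
      ((hint_ε k i).const_mul α)).abs
  -- the averaged optimality gap
  obtain ⟨A, hA⟩ : ∃ A : ℕ → ℝ, ∀ k, A k = 1 / (m : ℝ) *
      ∑ i, ∫ ω, (ψ k i ω xstar + εψ k i ω - M xstar) ∂P := ⟨_, fun _ => rfl⟩
  have hx : ∀ k, 1 / (m : ℝ) * ∑ i, ∫ ω, ‖xt k i ω - xstar‖ ^ 2 ∂P ≤ 2 / μM * A k := by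
    intro k
    rw [hA, mul_left_comm]
    refine mul_le_mul_of_nonneg_left ?_ (by positivity)
    rw [Finset.mul_sum]
    refine Finset.sum_le_sum fun i _ => ?_
    rw [← integral_const_mul]
    refine integral_mono_ae (hint_xt k i) ((hY k i).const_mul _) ?_
    filter_upwards [has] with ω hω
    obtain ⟨-, h2, h3, -⟩ := hω i k
    have h4 := h2 xstar
    have h5 := hgrowth (xt k i ω)
    have h6 : μM / 2 * ‖xt k i ω - xstar‖ ^ 2 ≤ ψ k i ω xstar + εψ k i ω - M xstar := by
      linarith
    calc ‖xt k i ω - xstar‖ ^ 2 = 2 / μM * (μM / 2 * ‖xt k i ω - xstar‖ ^ 2) := by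
          field_simp
      _ ≤ _ := mul_le_mul_of_nonneg_left h6 (by positivity)
  have hA0 : 0 ≤ A 0 := by
    have h1 := hx 0
    have h2 : 0 ≤ 1 / (m : ℝ) * ∑ i, ∫ ω, ‖xt 0 i ω - xstar‖ ^ 2 ∂P :=
      mul_nonneg (by positivity)
        (Finset.sum_nonneg fun i _ => integral_nonneg fun ω => by positivity)
    exact nonneg_of_mul_nonneg_right (h2.trans h1) (by positivity)
  have hstep : ∀ k, A (k + 1) ≤ (1 - α) * A k + C * (1 - c * α) ^ k := by
    intro k
    refine le_trans ?_ (add_le_add_right (herr k) _)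
    rw [hA, hA, mul_left_comm, ← mul_add]
    refine mul_le_mul_of_nonneg_left ?_ (by positivity)
    rw [Finset.mul_sum, ← Finset.sum_add_distrib]
    refine Finset.sum_le_sum fun i _ => ?_
    rw [← integral_const_mul, ← integral_add ((hY k i).const_mul _) (hT k i)]
    refine integral_mono_ae (hY (k + 1) i) (((hY k i).const_mul _).add (hT k i)) ?_
    filter_upwards [has] with ω hω
    obtain ⟨h1, -, -, -⟩ := hω i k
    have h2 := le_abs_self (εψ (k + 1) i ω - (1 - α) * εψ k i ω + α * ε k i ω)
    linarith
  have hA0' : A 0 = 1 / (m : ℝ) * ∑ i, (ψ0 i - M xstar) := by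
    rw [hA]
    congr 1
    refine Finset.sum_congr rfl fun i _ => ?_
    have : (fun ω => ψ 0 i ω xstar + εψ 0 i ω - M xstar) =ᵐ[P] fun _ => ψ0 i - M xstar := by
      filter_upwards [has] with ω hω
      rw [(hω i 0).2.2.2, hψ0, add_zero]
    rw [integral_congr_ae this]
    simp
  have hmain : ∀ k, A k ≤ (1 - c * α) ^ k * (A 0 + C / (α * (1 - c))) := by
    intro k
    induction k with
    | zero => simpa using div_nonneg hC hδ.le
    | succ k ih =>
      have hqk : 0 ≤ (1 - c * α) ^ k := by positivity
      have h1 : (1 - α) * A k ≤ (1 - α) * ((1 - c * α) ^ k * (A 0 + C / (α * (1 - c)))) :=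
        mul_le_mul_of_nonneg_left ih (by linarith)
      have h2 : C = α * (1 - c) * (C / (α * (1 - c))) := (mul_div_cancel₀ C hδ.ne').symm
      have h3 : 0 ≤ (1 - c * α) ^ k * (α * (1 - c) * A 0) := by positivity
      have h4 : C * (1 - c * α) ^ k
          = α * (1 - c) * (C / (α * (1 - c))) * (1 - c * α) ^ k := by rw [← h2]
      have h5 := hstep k
      generalize C / (α * (1 - c)) = D at *
      rw [pow_succ]
      nlinarith
  intro k
  refine (hx k).trans ?_
  have h1 : 1 / (m : ℝ) * ∑ i, 2 / μM * (ψ0 i - M xstar + C / (α * (1 - c)))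
      = 2 / μM * (A 0 + C / (α * (1 - c))) := by
    rw [hA0', ← Finset.mul_sum, Finset.sum_add_distrib, Finset.sum_const, Finset.card_univ,
      Fintype.card_fin, nsmul_eq_mul]
    generalize C / (α * (1 - c)) = D
    field_simp
  rw [h1, mul_left_comm]
  exact mul_le_mul_of_nonneg_left (hmain k) (by positivity)
end

section
/- Sublinear rate from inexact estimating sequences with polynomially decaying errors (Proposition 5(ii)). Let d, m ≥ 1, δ > 0, r₀ ∈ (0,1] and C ≥ 0. Let α^0 := (√5−1)/2 and, for k ≥ 1, let α^k be the unique solution in (0,1) of (α^k)² = (1−α^k)(α^{k−1})². Let M : ℝ^d → ℝ be differentiable with minimizer x⋆ and satisfy (1/(2δ))‖∇M(x)‖² ≤ M(x) − M(x⋆) for all x ∈ ℝ^d. On a probability space, for each i ∈ {1,…,m} let ψ_i^k (random functions ℝ^d → ℝ), ε_i^k, ψ_i^{k,⋆}, ε_{ψ,i}^k (random reals) and x̃_i^k (random vectors in ℝ^d) satisfy, almost surely for all i, k ≥ 0: ψ_i^{k+1}(x⋆) ≤ (1−α^k)ψ_i^k(x⋆) + α^k(M(x⋆)+ε_i^k);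 ψ_i^{k,⋆} ≤ ψ_i^k(x) for all x; M(x̃_i^k) ≤ ψ_i^{k,⋆} + ε_{ψ,i}^k; ε_{ψ,i}^0 = 0; each ψ_i^0(x⋆) is a deterministic real. Assume integrability and (1/m)∑_{i=1}^m E[|ε_{tot,i}^k|] ≤ C/(k+1)^{3+r₀} for all k ≥ 0, where ε_{tot,i}^k := ε_{ψ,i}^{k+1} − (1−α^k)ε_{ψ,i}^k + α^k ε_i^k. Then for every k ≥ 0: (1/(2δm))∑_{i=1}^m E[‖∇M(x̃_i^k)‖²] ≤ (4/(k+2)²) · (1/m)∑_{i=1}^m (ψ_i^0(x⋆) − M(x⋆) + 10C/r₀). -/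
open MeasureTheory

lemma aux_sum_bound (r : ℝ) (h0 : 0 < r) (h1 : r ≤ 1) (k : ℕ) :
    ∑ j ∈ Finset.range (k + 1), ((j : ℝ) + 1) ^ (-(1 + r))
      ≤ 1 + 1 / r - ((k : ℝ) + 1) ^ (-r) / r := by
  induction k with
  | zero => simp
  | succ k ih =>
    rw [Finset.sum_range_succ]
    push_cast
    set x : ℝ := (k : ℝ) + 1 with hx
    have hxpos : 0 < x := by positivity
    have hx1 : 0 < x + 1 := by positivity
    have key : r * (x + 1) ^ (-(1 + r)) ≤ x ^ (-r) - (x + 1) ^ (-r) := by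
      have hb : (1 + (-(1 / (x + 1)))) ^ r ≤ 1 + r * (-(1 / (x + 1))) := by
        apply rpow_one_add_le_one_add_mul_self _ h0.le h1
        have : 1 / (x + 1) ≤ 1 := by
          rw [div_le_one hx1]; linarith
        linarith
      have he : 1 + (-(1 / (x + 1))) = x / (x + 1) := by field_simp; ring
      rw [he, Real.div_rpow hxpos.le hx1.le] at hb
      have e1 : (x + 1) ^ (-(1 + r)) = (x + 1)⁻¹ * ((x + 1) ^ r)⁻¹ := by
        rw [neg_add, Real.rpow_add hx1, Real.rpow_neg_one, Real.rpow_neg hx1.le]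
      rw [e1, Real.rpow_neg hxpos.le, Real.rpow_neg hx1.le]
      have hp : 0 < x ^ r := Real.rpow_pos_of_pos hxpos r
      have hq : 0 < (x + 1) ^ r := Real.rpow_pos_of_pos hx1 r
      generalize x ^ r = p at *
      generalize (x + 1) ^ r = q at *
      have ht : 0 < (x + 1)⁻¹ := by positivity
      rw [one_div] at hb
      generalize (x + 1)⁻¹ = t at *
      have hb2 : p ≤ (1 - r * t) * q := by
        rw [div_le_iff₀ hq] at hb; linarith
      have h3 : (1 + r * t) * p ≤ q := by
        have : (1 + r * t) * p ≤ (1 + r * t) * ((1 - r * t) * q) := by gcongr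
        nlinarith [mul_nonneg (sq_nonneg (r * t)) hq.le]
      have h4 : (1 + r * t) * q⁻¹ ≤ p⁻¹ := by
        rw [← div_eq_mul_inv, div_le_iff₀ hq, ← div_eq_inv_mul, le_div_iff₀ hp]
        exact h3
      linarith
    have k2 : (x + 1) ^ (-(1 + r)) ≤ (x ^ (-r) - (x + 1) ^ (-r)) / r := by
      rw [le_div_iff₀ h0]; linarith
    rw [sub_div] at k2
    linarith

lemma aux_sum_bound2 (r : ℝ) (h0 : 0 < r) (h1 : r ≤ 1) (k : ℕ) :
    ∑ j ∈ Finset.range k, ((j : ℝ) + 1) ^ (-(1 + r)) ≤ 2 / r := by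
  have h : (1 : ℝ) ≤ 1 / r := by rw [le_div_iff₀ h0]; linarith
  have e : 2 / r = 1 / r + 1 / r := by ring
  cases k with
  | zero => simp; positivity
  | succ k =>
    have := aux_sum_bound r h0 h1 k
    have : 0 ≤ ((k : ℝ) + 1) ^ (-r) / r := by positivity
    linarith

lemma aux_alpha (α : ℕ → ℝ) (hα0 : α 0 = (Real.sqrt 5 - 1) / 2)
    (hαmem : ∀ k, α (k + 1) ∈ Set.Ioo (0 : ℝ) 1)
    (hαrec : ∀ k, (α (k + 1)) ^ 2 = (1 - α (k + 1)) * (α k) ^ 2) (k : ℕ) :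
    α k ≤ 2 / ((k : ℝ) + 3) ∧ 1 / (2 * ((k : ℝ) + 1)) ≤ α k := by
  induction k with
  | zero =>
    have h1 : Real.sqrt 5 ≤ 7 / 3 := by
      rw [Real.sqrt_le_left (by norm_num)]; norm_num
    have h2 : 2 ≤ Real.sqrt 5 := by
      apply Real.le_sqrt_of_sq_le; norm_num
    rw [hα0]
    constructor <;> norm_num <;> linarith
  | succ k ih =>
    obtain ⟨hu, hl⟩ := ih
    obtain ⟨ha0, ha1⟩ := hαmem k
    have hr := hαrec k
    generalize α (k + 1) = a at *
    generalize α k = b at *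
    push_cast
    have hx : (0 : ℝ) ≤ k := by positivity
    generalize (k : ℝ) = x at *
    have hb0 : 0 < b := lt_of_lt_of_le (by positivity) hl
    rw [le_div_iff₀ (by positivity)] at hu
    rw [div_le_iff₀ (by positivity)] at hl
    constructor
    · rw [le_div_iff₀ (by positivity)]
      by_contra hcon
      push Not at hcon
      have e1 : (b * (x + 3)) ^ 2 ≤ 2 ^ 2 := by gcongr
      have e2 : a ^ 2 * (x + 3) ^ 2 ≤ (1 - a) * 4 := by
        have : a ^ 2 * (x + 3) ^ 2 = (1 - a) * (b * (x + 3)) ^ 2 := by rw [hr]; ring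
        rw [this]; apply mul_le_mul_of_nonneg_left _ (by linarith); linarith
      have e3 : a * (x + 2) * 2 ≤ a * (x + 2) * (a * (x + 4)) := by
        apply mul_le_mul_of_nonneg_left (by linarith) (by positivity)
      nlinarith [sq_nonneg a, mul_pos ha0 ha0]
    · rw [div_le_iff₀ (by positivity)]
      by_contra hcon
      push Not at hcon
      have e1 : 1 ≤ (b * (2 * (x + 1))) ^ 2 := one_le_pow₀ hl
      have e2 : (1 - a) ≤ a ^ 2 * (2 * (x + 1)) ^ 2 := by
        have : a ^ 2 * (2 * (x + 1)) ^ 2 = (1 - a) * (b * (2 * (x + 1))) ^ 2 := by rw [hr]; ring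
        rw [this]; nlinarith
      set s := a * (x + 1) with hs
      have hs' : 0 < s := by positivity
      have c1 : 2 * s + 2 * a < 1 := by rw [hs]; linarith
      have e3 : 1 - a ≤ 4 * s ^ 2 := by rw [hs]; linarith
      nlinarith

/-- accumulated product of the factors `1 - α k` -/
def auxLam (α : ℕ → ℝ) : ℕ → ℝ
  | 0 => 1
  | k + 1 => α k ^ 2

lemma aux_rec (r C : ℝ) (h0 : 0 < r) (h1 : r ≤ 1) (hC : 0 ≤ C)
    (α : ℕ → ℝ) (hα0 : α 0 = (Real.sqrt 5 - 1) / 2)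
    (hαmem : ∀ k, α (k + 1) ∈ Set.Ioo (0 : ℝ) 1)
    (hαrec : ∀ k, (α (k + 1)) ^ 2 = (1 - α (k + 1)) * (α k) ^ 2)
    (A : ℕ → ℝ) (hA0 : 0 ≤ A 0)
    (hA : ∀ k : ℕ, A (k + 1) ≤ (1 - α k) * A k + C / ((k : ℝ) + 1) ^ ((3 : ℝ) + r)) (k : ℕ) :
    A k ≤ 4 / ((k : ℝ) + 2) ^ 2 * (A 0 + 10 * C / r) := by
  have hb := aux_alpha α hα0 hαmem hαrec
  have hlam : ∀ k, auxLam α (k + 1) = (1 - α k) * auxLam α k := by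
    intro k
    cases k with
    | zero =>
      simp only [auxLam, hα0]
      have := Real.sq_sqrt (show (0 : ℝ) ≤ 5 by norm_num)
      nlinarith
    | succ k => exact hαrec k
  have hle : auxLam α k ≤ 4 / ((k : ℝ) + 2) ^ 2 := by
    cases k with
    | zero => norm_num [auxLam]
    | succ k =>
      have h2 : 0 ≤ α k := le_trans (by positivity) (hb k).2
      have : α k ^ 2 ≤ (2 / ((k : ℝ) + 3)) ^ 2 := by
        gcongr; exact (hb k).1
      simp only [auxLam]
      push_cast
      refine this.trans (le_of_eq ?_)
      rw [div_pow]; ring_nf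
  have hnn : 0 ≤ auxLam α k := by
    cases k with
    | zero => norm_num [auxLam]
    | succ k => simp only [auxLam]; positivity
  have hmain : ∀ k, A k ≤ auxLam α k *
      (A 0 + 4 * C * ∑ j ∈ Finset.range k, ((j : ℝ) + 1) ^ (-(1 + r))) := by
    intro k
    induction k with
    | zero => simp [auxLam]
    | succ k ih =>
      have h1a : 0 ≤ 1 - α k := by
        have h3 := (hb k).1
        have : 2 / ((k : ℝ) + 3) ≤ 1 := by
          rw [div_le_one (by positivity)]; linarith [show (0 : ℝ) ≤ k by positivity]
        linarith
      have h2 := hA k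
      have h3 := mul_le_mul_of_nonneg_left ih h1a
      rw [← mul_assoc, ← hlam] at h3
      have hx : 0 < (k : ℝ) + 1 := by positivity
      have h4 : C / ((k : ℝ) + 1) ^ ((3 : ℝ) + r)
          ≤ auxLam α (k + 1) * (4 * C * ((k : ℝ) + 1) ^ (-(1 + r))) := by
        have e : C / ((k : ℝ) + 1) ^ ((3 : ℝ) + r)
            = (1 / (2 * ((k : ℝ) + 1))) ^ 2 * (4 * C * ((k : ℝ) + 1) ^ (-(1 + r))) := by
          rw [show (3 : ℝ) + r = 2 + (1 + r) by ring, Real.rpow_add hx, Real.rpow_neg hx.le,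
            Real.rpow_two]
          field_simp
          norm_num
        rw [e]
        simp only [auxLam]
        gcongr
        exact (hb k).2
      rw [Finset.sum_range_succ]
      linarith
  have hS := aux_sum_bound2 r h0 h1 k
  have h10 : 4 * C * ∑ j ∈ Finset.range k, ((j : ℝ) + 1) ^ (-(1 + r)) ≤ 10 * C / r := by
    calc _ ≤ 4 * C * (2 / r) := by gcongr
      _ = 8 * C / r := by ring
      _ ≤ 10 * C / r := by gcongr; norm_num
  calc A k ≤ _ := hmain k
    _ ≤ auxLam α k * (A 0 + 10 * C / r) := by gcongr
    _ ≤ _ := by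
      apply mul_le_mul_of_nonneg_right hle
      positivity

/-- **Sublinear rate from inexact estimating sequences with polynomially decaying errors**
(Proposition 5(ii)). With the Nesterov coefficients `α^0 = (√5−1)/2`,
`(α^k)² = (1−α^k)(α^{k−1})²`, `α^k ∈ (0,1)`, a differentiable `M` minimized at `x⋆` with
`(1/(2δ))‖∇M(x)‖² ≤ M(x)−M(x⋆)`, and random inexact estimating sequences as in
Proposition 5(i), if `(1/m)∑_i E[|ε_{tot,i}^k|] ≤ C/(k+1)^{3+r₀}` for all `k`, then
`(1/(2δm))∑_i E[‖∇M(x̃_i^k)‖²] ≤ (4/(k+2)²)(1/m)∑_i (ψ_i^0(x⋆)−M(x⋆)+10C/r₀)`. -/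
theorem inexact_estimating_sequences_sublinear_rate
    (d m : ℕ) (hd : 1 ≤ d) (hm : 1 ≤ m)
    (δ r₀ C : ℝ) (hδ : 0 < δ) (hr₀ : r₀ ∈ Set.Ioc (0 : ℝ) 1) (hC : 0 ≤ C)
    (α : ℕ → ℝ) (hα0 : α 0 = (Real.sqrt 5 - 1) / 2)
    (hαmem : ∀ k, α (k + 1) ∈ Set.Ioo (0 : ℝ) 1)
    (hαrec : ∀ k, (α (k + 1)) ^ 2 = (1 - α (k + 1)) * (α k) ^ 2)
    (M : EuclideanSpace ℝ (Fin d) → ℝ)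
    (M' : EuclideanSpace ℝ (Fin d) → EuclideanSpace ℝ (Fin d))
    (hgrad : ∀ x, HasGradientAt M (M' x) x)
    (xstar : EuclideanSpace ℝ (Fin d)) (hmin : ∀ x, M xstar ≤ M x)
    (hgrowth : ∀ x, 1 / (2 * δ) * ‖M' x‖ ^ 2 ≤ M x - M xstar)
    {Ω : Type*} [MeasurableSpace Ω] (P : Measure Ω) [IsProbabilityMeasure P]
    (ψ : ℕ → Fin m → Ω → EuclideanSpace ℝ (Fin d) → ℝ)
    (ε ψs εψ : ℕ → Fin m → Ω → ℝ)
    (xt : ℕ → Fin m → Ω → EuclideanSpace ℝ (Fin d))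
    -- almost-sure structural properties
    (has : ∀ᵐ ω ∂P, ∀ (i : Fin m) (k : ℕ),
      (ψ (k + 1) i ω xstar
          ≤ (1 - α k) * ψ k i ω xstar + α k * (M xstar + ε k i ω))
      ∧ (∀ x, ψs k i ω ≤ ψ k i ω x)
      ∧ (M (xt k i ω) ≤ ψs k i ω + εψ k i ω)
      ∧ εψ 0 i ω = 0)
    -- `ψ_i^0(x⋆)` is deterministic
    (ψ0 : Fin m → ℝ) (hψ0 : ∀ i ω, ψ 0 i ω xstar = ψ0 i)
    -- integrability of all the involved quantities
    (hint_ψ : ∀ k i, Integrable (fun ω => ψ k i ω xstar) P)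
    (hint_ε : ∀ k i, Integrable (fun ω => ε k i ω) P)
    (hint_ψs : ∀ k i, Integrable (fun ω => ψs k i ω) P)
    (hint_εψ : ∀ k i, Integrable (fun ω => εψ k i ω) P)
    (hint_grad : ∀ k i, Integrable (fun ω => ‖M' (xt k i ω)‖ ^ 2) P)
    -- polynomial decay of the total errors
    (herr : ∀ k : ℕ,
      1 / (m : ℝ) * ∑ i, ∫ ω,
          |εψ (k + 1) i ω - (1 - α k) * εψ k i ω + α k * ε k i ω| ∂P
        ≤ C / ((k : ℝ) + 1) ^ ((3 : ℝ) + r₀)) :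
    ∀ k : ℕ,
      1 / (2 * δ * (m : ℝ)) * ∑ i, ∫ ω, ‖M' (xt k i ω)‖ ^ 2 ∂P
        ≤ 4 / ((k : ℝ) + 2) ^ 2
          * (1 / (m : ℝ) * ∑ i, (ψ0 i - M xstar + 10 * C / r₀)) := by
  have hm0 : (0 : ℝ) < m := by exact_mod_cast hm
  have hI : ∀ k i, Integrable (fun ω => ψ k i ω xstar - M xstar + εψ k i ω) P := fun k i =>
    ((hint_ψ k i).sub (integrable_const _)).add (hint_εψ k i)
  have hE : ∀ k i, Integrable
      (fun ω => |εψ (k + 1) i ω - (1 - α k) * εψ k i ω + α k * ε k i ω|) P := fun k i =>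
    (((hint_εψ (k + 1) i).sub ((hint_εψ k i).const_mul _)).add ((hint_ε k i).const_mul _)).abs
  have hgr : ∀ k i, 1 / (2 * δ) * ∫ ω, ‖M' (xt k i ω)‖ ^ 2 ∂P
      ≤ ∫ ω, (ψ k i ω xstar - M xstar + εψ k i ω) ∂P := by
    intro k i
    rw [← integral_const_mul]
    apply integral_mono_ae ((hint_grad k i).const_mul _) (hI k i)
    filter_upwards [has] with ω hω
    obtain ⟨-, h2, h3, -⟩ := hω i k
    have := hgrowth (xt k i ω)
    have := h2 xstar
    linarith
  have hstep : ∀ k i, ∫ ω, (ψ (k + 1) i ω xstar - M xstar + εψ (k + 1) i ω) ∂P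
      ≤ (1 - α k) * ∫ ω, (ψ k i ω xstar - M xstar + εψ k i ω) ∂P
        + ∫ ω, |εψ (k + 1) i ω - (1 - α k) * εψ k i ω + α k * ε k i ω| ∂P := by
    intro k i
    rw [← integral_const_mul, ← integral_add ((hI k i).const_mul _) (hE k i)]
    apply integral_mono_ae (hI (k + 1) i) (((hI k i).const_mul _).add (hE k i))
    filter_upwards [has] with ω hω
    obtain ⟨h1, -, -, -⟩ := hω i k
    have := le_abs_self (εψ (k + 1) i ω - (1 - α k) * εψ k i ω + α k * ε k i ω)
    simp only [Pi.add_apply]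
    linarith
  have hzero : ∀ i, ∫ ω, (ψ 0 i ω xstar - M xstar + εψ 0 i ω) ∂P = ψ0 i - M xstar := by
    intro i
    have : (fun ω => ψ 0 i ω xstar - M xstar + εψ 0 i ω) =ᵐ[P] fun _ => ψ0 i - M xstar := by
      filter_upwards [has] with ω hω
      rw [hψ0, (hω i 0).2.2.2, add_zero]
    rw [integral_congr_ae this]
    simp
  have hA0 : 0 ≤ 1 / (m : ℝ) * ∑ i, ∫ ω, (ψ 0 i ω xstar - M xstar + εψ 0 i ω) ∂P := by
    apply mul_nonneg (by positivity)
    apply Finset.sum_nonneg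
    intro i _
    refine le_trans ?_ (hgr 0 i)
    apply mul_nonneg (by positivity)
    exact integral_nonneg fun ω => by positivity
  intro k
  have hfin := aux_rec r₀ C hr₀.1 hr₀.2 hC α hα0 hαmem hαrec
    (fun k => 1 / (m : ℝ) * ∑ i, ∫ ω, (ψ k i ω xstar - M xstar + εψ k i ω) ∂P) hA0
    (by
      intro k
      have h1 := Finset.sum_le_sum fun i (_ : i ∈ Finset.univ) => hstep k i
      rw [Finset.sum_add_distrib, ← Finset.mul_sum] at h1
      have h2 := mul_le_mul_of_nonneg_left h1 (show 0 ≤ 1 / (m : ℝ) by positivity)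
      have h3 := herr k
      rw [mul_add, mul_left_comm] at h2
      linarith) k
  simp only [hzero] at hfin
  have hsum : 1 / (m : ℝ) * ∑ i, (ψ0 i - M xstar + 10 * C / r₀)
      = 1 / (m : ℝ) * ∑ i, (ψ0 i - M xstar) + 10 * C / r₀ := by
    rw [Finset.sum_add_distrib, mul_add]
    congr 1
    simp only [Finset.sum_const, Finset.card_univ, Fintype.card_fin, nsmul_eq_mul]
    field_simp
  rw [hsum]
  refine le_trans ?_ hfin
  have h1 := Finset.sum_le_sum fun i (_ : i ∈ Finset.univ) => hgr k i
  rw [← Finset.mul_sum] at h1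
  have h2 := mul_le_mul_of_nonneg_left h1 (show 0 ≤ 1 / (m : ℝ) by positivity)
  refine le_trans (le_of_eq ?_) h2
  rw [← mul_assoc]
  congr 1
  field_simp
end

section
/- Maintenance of the inexact lower-bound property along the DCatalyst recursions (Lemma 9). Let d ≥ 1, δ > 0, μ_M ≥ 0, and let M : ℝ^d → ℝ be differentiable and satisfy, for all x, z ∈ ℝ^d, both M(x) ≥ M(z) + ⟨∇M(z), x−z⟩ + (μ_M/2)‖x−z‖² and M(x) ≤ M(z) + ⟨∇M(z), x−z⟩ + (δ/2)‖x−z‖². Let α^k ∈ (0,1) satisfy δ(α^0)² > α^0 μ_M and δ(α^k)² = (1−α^k)·δ(α^{k−1})² + α^k μ_M for all k ≥ 1. Let x̃^k ∈ ℝ^d (k ≥ 0) be an arbitrary sequence, set z̃^0 := x̃^0 and z̃^{k+1} := x̃^{k+1} + (α^k(1−α^k)/((α^k)²+α^{k+1}))·(x̃^{k+1}−x̃^k), and define e^k := δ(z̃^k − x̃^{k+1}) − ∇M(z̃^k). Initialize ψ^{0,⋆} := M(x̃^0), v^0 := x̃^0, ζ^0 := (δ(α^0)² − α^0 μ_M)/(1−α^0),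 and define ζ^{k+1} := (1−α^k)ζ^k + α^k μ_M, v^{k+1} := ((1−α^k)ζ^k/ζ^{k+1})v^k + (α^k μ_M/ζ^{k+1})z̃^k − (α^k/ζ^{k+1})(∇M(z̃^k)+e^k), and ψ^{k+1,⋆} := (1−α^k)ψ^{k,⋆} + α^k M(z̃^k) − ((α^k)²/(2ζ^{k+1}))‖∇M(z̃^k)+e^k‖² + (α^k(1−α^k)ζ^k/ζ^{k+1})(⟨∇M(z̃^k)+e^k, v^k−z̃^k⟩ + (μ_M/2)‖z̃^k−v^k‖²). Finally set ε_ψ^0 := 0 and ε_ψ^{k+1} := (1−α^k)ε_ψ^k + (1−α^k)⟨e^k, x̃^k − z̃^k⟩ + ⟨e^k + ∇M(z̃^k), (1/δ)e^k⟩. Then for every k ≥ 0: M(x̃^k) ≤ ψ^{k,⋆} + ε_ψ^k. -/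
open scoped RealInnerProductSpace

/-- **Maintenance of the inexact lower-bound property along the DCatalyst recursions**
(Lemma 9). With `M` being `μ_M`-strongly convex and `δ`-smooth, coefficients `α^k ∈ (0,1)`
satisfying the compatibility condition `δ(α^k)² = (1−α^k)δ(α^{k−1})² + α^k μ_M`, the
extrapolation sequence `z̃^k`, the error vectors `e^k := δ(z̃^k−x̃^{k+1}) − ∇M(z̃^k)`, and
the canonical-form sequences `ζ^k, v^k, ψ^{k,⋆}` initialized at `ψ^{0,⋆} = M(x̃^0)`,
`v^0 = x̃^0`, `ζ^0 = (δ(α^0)²−α^0μ_M)/(1−α^0)`, the inexact lower-bound property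
`M(x̃^k) ≤ ψ^{k,⋆} + ε_ψ^k` is maintained, where `ε_ψ^0 = 0` and
`ε_ψ^{k+1} = (1−α^k)ε_ψ^k + (1−α^k)⟪e^k, x̃^k−z̃^k⟫ + ⟪e^k+∇M(z̃^k), (1/δ)e^k⟫`. -/
theorem dcatalyst_lower_bound_maintained
    (d : ℕ) (hd : 1 ≤ d) (δ μM : ℝ) (hδ : 0 < δ) (hμM : 0 ≤ μM)
    (M : EuclideanSpace ℝ (Fin d) → ℝ)
    (M' : EuclideanSpace ℝ (Fin d) → EuclideanSpace ℝ (Fin d))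
    (hgrad : ∀ x, HasGradientAt M (M' x) x)
    (hsc : ∀ x z, M x ≥ M z + ⟪M' z, x - z⟫ + μM / 2 * ‖x - z‖ ^ 2)
    (hsm : ∀ x z, M x ≤ M z + ⟪M' z, x - z⟫ + δ / 2 * ‖x - z‖ ^ 2)
    (α : ℕ → ℝ) (hα : ∀ k, α k ∈ Set.Ioo (0 : ℝ) 1)
    (hα0 : δ * (α 0) ^ 2 > α 0 * μM)
    (hαrec : ∀ k, δ * (α (k + 1)) ^ 2
      = (1 - α (k + 1)) * (δ * (α k) ^ 2) + α (k + 1) * μM)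
    (xt zt e : ℕ → EuclideanSpace ℝ (Fin d))
    (hzt0 : zt 0 = xt 0)
    (hztrec : ∀ k, zt (k + 1) = xt (k + 1)
      + (α k * (1 - α k) / ((α k) ^ 2 + α (k + 1))) • (xt (k + 1) - xt k))
    (he : ∀ k, e k = δ • (zt k - xt (k + 1)) - M' (zt k))
    (ζ : ℕ → ℝ) (v : ℕ → EuclideanSpace ℝ (Fin d)) (ψs : ℕ → ℝ)
    (hψs0 : ψs 0 = M (xt 0)) (hv0 : v 0 = xt 0)
    (hζ0 : ζ 0 = (δ * (α 0) ^ 2 - α 0 * μM) / (1 - α 0))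
    (hζ : ∀ k, ζ (k + 1) = (1 - α k) * ζ k + α k * μM)
    (hv : ∀ k, v (k + 1) = ((1 - α k) * ζ k / ζ (k + 1)) • v k
      + (α k * μM / ζ (k + 1)) • zt k - (α k / ζ (k + 1)) • (M' (zt k) + e k))
    (hψs : ∀ k, ψs (k + 1) = (1 - α k) * ψs k + α k * M (zt k)
      - (α k) ^ 2 / (2 * ζ (k + 1)) * ‖M' (zt k) + e k‖ ^ 2
      + α k * (1 - α k) * ζ k / ζ (k + 1)
        * (⟪M' (zt k) + e k, v k - zt k⟫ + μM / 2 * ‖zt k - v k‖ ^ 2))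
    (εψ : ℕ → ℝ) (hεψ0 : εψ 0 = 0)
    (hεψ : ∀ k, εψ (k + 1) = (1 - α k) * εψ k + (1 - α k) * ⟪e k, xt k - zt k⟫
      + ⟪e k + M' (zt k), (1 / δ) • e k⟫) :
    ∀ k, M (xt k) ≤ ψs k + εψ k := by
  have hζs : ∀ k, ζ (k + 1) = δ * (α k) ^ 2 := by
    intro k
    induction k with
    | zero =>
      have h1 : (1 - α 0) ≠ 0 := by linarith [(hα 0).2]
      have h2 : (1 - α 0) * ζ 0 = δ * (α 0) ^ 2 - α 0 * μM := by
        rw [hζ0]; field_simp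
      rw [hζ 0, h2]; ring
    | succ n ih => rw [hζ (n + 1), ih, hαrec n]
  have hζpos : ∀ k, 0 < ζ k := by
    intro k
    cases k with
    | zero =>
      rw [hζ0]
      exact div_pos (by linarith) (by linarith [(hα 0).2])
    | succ n =>
      rw [hζs n]
      have := (hα n).1
      positivity
  have hg : ∀ k, M' (zt k) + e k = δ • (zt k - xt (k + 1)) := by
    intro k; rw [he k]; abel
  have hinv : ∀ k, ζ (k + 1) • (xt k - zt k) + (α k * ζ k) • (v k - zt k) = 0 := by
    intro k
    induction k with
    | zero => rw [hzt0, hv0]; simp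
    | succ n ih =>
      have ha := (hα n).1
      have hb := (hα (n + 1)).1
      ext i
      have ih' := congrArg (fun w : EuclideanSpace ℝ (Fin d) => w i) ih
      have hv' := congrArg (fun w : EuclideanSpace ℝ (Fin d) => w i) (hv n)
      have hz' := congrArg (fun w : EuclideanSpace ℝ (Fin d) => w i) (hztrec n)
      rw [hg n] at hv'
      have hr := hζ n
      have hp := (hζpos (n + 1)).ne'
      rw [hζs (n + 1), hζs n]
      rw [hζs n] at hv' ih' hr
      simp only [PiLp.add_apply, PiLp.sub_apply, PiLp.smul_apply, smul_eq_mul,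
        PiLp.zero_apply] at ih' hv' hz' ⊢
      generalize xt (n + 1) i = X at *
      generalize xt n i = x at *
      generalize zt (n + 1) i = Z at *
      generalize zt n i = z at *
      generalize v (n + 1) i = V at *
      generalize v n i = w at *
      generalize α (n + 1) = b at *
      generalize α n = a at *
      generalize ζ n = s at *
      have hab : a ^ 2 + b ≠ 0 := by positivity
      have h1 : (a ^ 2 + b) * (Z - X) = a * (1 - a) * (X - x) := by
        rw [hz']; field_simp; ring
      have h2 : δ * a ^ 2 * V = (1 - a) * s * w + a * μM * z - a * (δ * (z - X)) := by
        rw [hv']; field_simp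
      have h3 : δ * a * (x - z) + s * (w - z) = 0 := by
        have : a * (δ * a * (x - z) + s * (w - z)) = 0 := by linear_combination ih'
        rcases mul_eq_zero.mp this with h | h
        · exact absurd h ha.ne'
        · exact h
      have h4 : a * V = X - (1 - a) * x := by
        have : (δ * a) * (a * V - (X - (1 - a) * x)) = 0 := by
          linear_combination h2 + (1 - a) * h3 - z * hr
        rcases mul_eq_zero.mp this with h | h
        · exact absurd h (by positivity)
        · linarith
      linear_combination (δ * b * a) * h4 - (δ * b) * h1
  intro k
  induction k with
  | zero => rw [hψs0, hεψ0]; simp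
  | succ n ih =>
    have ha := (hα n).1
    have ha1 := (hα n).2
    have hs := hζpos n
    have hs1 := hζpos (n + 1)
    have hsm1 := hsm (xt (n + 1)) (zt n)
    have hsc1 := hsc (xt n) (zt n)
    have hx : xt (n + 1) - zt n = -((1 / δ) • (M' (zt n) + e n)) := by
      rw [hg n, smul_smul, one_div_mul_cancel hδ.ne', one_smul]; abel
    have hi := congrArg (fun w => ⟪M' (zt n) + e n, w⟫) (hinv n)
    simp only [inner_add_right, inner_smul_right, inner_zero_right] at hi
    have hM' : M' (zt n) = (M' (zt n) + e n) - e n := by abel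
    rw [hx, norm_neg, norm_smul, inner_neg_right, inner_smul_right] at hsm1
    rw [hψs n, hεψ n, add_comm (e n), inner_smul_right]
    generalize hG : M' (zt n) + e n = g at *
    rw [hM', inner_sub_left, real_inner_self_eq_norm_sq, real_inner_comm] at hsm1
    rw [hM', inner_sub_left] at hsc1
    have hsq : (‖(1 / δ : ℝ)‖ * ‖g‖) ^ 2 = (1 / δ) ^ 2 * ‖g‖ ^ 2 := by
      rw [mul_pow, Real.norm_eq_abs, sq_abs]
    rw [hsq] at hsm1
    have hA : δ / 2 * ((1 / δ) ^ 2 * ‖g‖ ^ 2) = 1 / δ * ‖g‖ ^ 2 / 2 := by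
      field_simp
    have hB : α n ^ 2 / (2 * ζ (n + 1)) * ‖g‖ ^ 2 = 1 / δ * ‖g‖ ^ 2 / 2 := by
      rw [hζs n]; field_simp
    have hC : α n * (1 - α n) * ζ n / ζ (n + 1) * (⟪g, v n - zt n⟫ + μM / 2 * ‖zt n - v n‖ ^ 2)
        ≥ -(1 - α n) * ⟪g, xt n - zt n⟫ := by
      have e1 : α n * (1 - α n) * ζ n / ζ (n + 1) * ⟪g, v n - zt n⟫
          = -(1 - α n) * ⟪g, xt n - zt n⟫ := by
        rw [div_mul_eq_mul_div, div_eq_iff hs1.ne']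
        simp only [inner_sub_right] at hi ⊢
        linear_combination (1 - α n) * hi
      have e2 : 0 ≤ α n * (1 - α n) * ζ n / ζ (n + 1) * (μM / 2 * ‖zt n - v n‖ ^ 2) := by
        have : 0 < 1 - α n := by linarith
        positivity
      rw [mul_add, e1]; linarith
    have hD : (1 - α n) * M (xt n) ≤ (1 - α n) * (ψs n + εψ n) :=
      mul_le_mul_of_nonneg_left ih (by linarith)
    have hE : (1 - α n) * (M (zt n) + (⟪g, xt n - zt n⟫ - ⟪e n, xt n - zt n⟫))
        ≤ (1 - α n) * M (xt n) := by
      refine mul_le_mul_of_nonneg_left ?_ (by linarith)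
      have : 0 ≤ μM / 2 * ‖xt n - zt n‖ ^ 2 := by positivity
      linarith
    rw [hA] at hsm1
    rw [hB]
    nlinarith [hsm1, hC, hD, hE]
end

section
/- Decay rate of the product of Nesterov coefficients in the convex regime (Lemma A.1 / 'Lemma lambdak'). Let α^0 := (√5−1)/2 and, for k ≥ 1, let α^k ∈ (0,1) satisfy (α^k)² = (1−α^k)(α^{k−1})². Define λ^k := ∏_{t=0}^{k−1}(1−α^t), with λ^0 := 1. Then for every k ≥ 0: 2/(k+2)² ≤ λ^k ≤ 4/(k+2)². -/
open Finset

/-- **Decay rate of the product of Nesterov coefficients in the convex regime**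
(Lemma lambdak). Let `α^0 = (√5−1)/2` and, for `k ≥ 1`, `α^k ∈ (0,1)` with
`(α^k)² = (1−α^k)(α^{k−1})²`. Then `λ^k := ∏_{t<k}(1−α^t)` satisfies
`2/(k+2)² ≤ λ^k ≤ 4/(k+2)²` for all `k ≥ 0`. -/
theorem lambda_product_decay
    (α : ℕ → ℝ) (hα0 : α 0 = (Real.sqrt 5 - 1) / 2)
    (hαmem : ∀ k, α (k + 1) ∈ Set.Ioo (0 : ℝ) 1)
    (hαrec : ∀ k, (α (k + 1)) ^ 2 = (1 - α (k + 1)) * (α k) ^ 2) :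
    ∀ k : ℕ, 2 / ((k : ℝ) + 2) ^ 2 ≤ ∏ t ∈ range k, (1 - α t) ∧
      ∏ t ∈ range k, (1 - α t) ≤ 4 / ((k : ℝ) + 2) ^ 2 := by
  have h5 : Real.sqrt 5 ^ 2 = 5 := Real.sq_sqrt (by norm_num)
  have h5l : 2.2 < Real.sqrt 5 := Real.lt_sqrt_of_sq_lt (by norm_num)
  have h5u : Real.sqrt 5 < 2.3 := by
    rw [Real.sqrt_lt' (by norm_num)]; norm_num
  have key : ∀ k : ℕ, 0 < α k ∧ ∏ t ∈ range (k + 1), (1 - α t) = (α k) ^ 2 ∧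
      ((k : ℝ) + 3) / 2 ≤ (α k)⁻¹ ∧ (α k)⁻¹ ≤ 0.7 * ((k : ℝ) + 3) := by
    intro k
    induction k with
    | zero =>
      have hinv : (α 0)⁻¹ = (Real.sqrt 5 + 1) / 2 := by
        apply inv_eq_of_mul_eq_one_right
        rw [hα0]; nlinarith
      refine ⟨by rw [hα0]; linarith, ?_, ?_, ?_⟩
      · simp only [zero_add, prod_range_one]
        rw [hα0]; nlinarith
      · rw [hinv]; push_cast; linarith
      · rw [hinv]; push_cast; linarith
    | succ k ih =>
      obtain ⟨hp, hprod, hl, hu⟩ := ih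
      obtain ⟨hq, hq1⟩ := hαmem k
      have hr := hαrec k
      have hs : ((α (k + 1))⁻¹) ^ 2 - (α (k + 1))⁻¹ = ((α k)⁻¹) ^ 2 := by
        field_simp
        linarith
      have hk : (0 : ℝ) ≤ k := Nat.cast_nonneg k
      have hs0 : 0 < (α (k + 1))⁻¹ := inv_pos.mpr hq
      refine ⟨hq, ?_, ?_, ?_⟩
      · rw [prod_range_succ, hprod, hr]; ring
      · generalize (α (k + 1))⁻¹ = s at *
        generalize (α k)⁻¹ = r at *
        push_cast
        by_contra! hc
        have : s < r + 1 / 2 := by linarith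
        nlinarith
      · generalize (α (k + 1))⁻¹ = s at *
        generalize (α k)⁻¹ = r at *
        push_cast
        by_contra! hc
        have : r + 0.7 < s := by linarith
        nlinarith
  intro k
  cases k with
  | zero => norm_num
  | succ k =>
    obtain ⟨hp, hprod, hl, hu⟩ := key k
    have hk : (0 : ℝ) ≤ k := Nat.cast_nonneg k
    have e : (α k) ^ 2 = 1 / ((α k)⁻¹) ^ 2 := by simp
    have hs0 : 0 < (α k)⁻¹ := inv_pos.mpr hp
    rw [hprod, e]
    generalize (α k)⁻¹ = s at *
    push_cast
    constructor
    · rw [div_le_div_iff₀ (by positivity) (by positivity)]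
      nlinarith
    · rw [div_le_div_iff₀ (by positivity) (by positivity)]
      nlinarith
end

section
/- Momentum-form identity for the auxiliary sequence v (implicit in the proof of Propositions 1 and 3). Let d ≥ 1, δ > 0, μ_M ≥ 0, and let α^k ∈ (0,1) satisfy δ(α^0)² > α^0 μ_M and δ(α^k)² = (1−α^k)·δ(α^{k−1})² + α^k μ_M for all k ≥ 1. Set ζ^0 := (δ(α^0)² − α^0 μ_M)/(1−α^0) and ζ^{k+1} := (1−α^k)ζ^k + α^k μ_M. Let w^k ∈ ℝ^d (k ≥ 0) be arbitrary vectors and define sequences in ℝ^d by: x^0 = z^0 = v^0; x^{k+1} := z^k − (1/δ)w^k; v^{k+1} := ((1−α^k)ζ^k/ζ^{k+1})·v^k + (α^k μ_M/ζ^{k+1})·z^k − (α^k/ζ^{k+1})·w^k; z^{k+1} := x^{k+1} + (α^k(1−α^k)/((α^k)²+α^{k+1}))·(x^{k+1} − x^k). Then for every k ≥ 0: v^{k+1} = x^{k+1} + ((1−α^k)/α^k)·(x^{k+1} − x^k). -/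
/-- **Momentum-form identity for the auxiliary sequence `v`** (implicit in the proofs of
Propositions 1 and 3). Under the compatibility condition on the coefficients `α^k` and
with `ζ^{k+1} = (1−α^k)ζ^k + α^k μ_M`, the sequences `x^{k+1} = z^k − (1/δ)w^k`,
`v^{k+1} = ((1−α^k)ζ^k/ζ^{k+1})v^k + (α^kμ_M/ζ^{k+1})z^k − (α^k/ζ^{k+1})w^k` and
`z^{k+1} = x^{k+1} + (α^k(1−α^k)/((α^k)²+α^{k+1}))(x^{k+1}−x^k)` (with
`x^0 = z^0 = v^0`) satisfy `v^{k+1} = x^{k+1} + ((1−α^k)/α^k)(x^{k+1}−x^k)`. -/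
theorem momentum_form_identity
    (d : ℕ) (hd : 1 ≤ d) (δ μM : ℝ) (hδ : 0 < δ) (hμM : 0 ≤ μM)
    (α : ℕ → ℝ) (hα : ∀ k, α k ∈ Set.Ioo (0 : ℝ) 1)
    (hα0 : δ * (α 0) ^ 2 > α 0 * μM)
    (hαrec : ∀ k, δ * (α (k + 1)) ^ 2
      = (1 - α (k + 1)) * (δ * (α k) ^ 2) + α (k + 1) * μM)
    (ζ : ℕ → ℝ)
    (hζ0 : ζ 0 = (δ * (α 0) ^ 2 - α 0 * μM) / (1 - α 0))
    (hζ : ∀ k, ζ (k + 1) = (1 - α k) * ζ k + α k * μM)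
    (w x z v : ℕ → EuclideanSpace ℝ (Fin d))
    (hx0 : x 0 = z 0) (hv0 : x 0 = v 0)
    (hx : ∀ k, x (k + 1) = z k - (1 / δ) • w k)
    (hv : ∀ k, v (k + 1) = ((1 - α k) * ζ k / ζ (k + 1)) • v k
      + (α k * μM / ζ (k + 1)) • z k - (α k / ζ (k + 1)) • w k)
    (hz : ∀ k, z (k + 1) = x (k + 1)
      + (α k * (1 - α k) / ((α k) ^ 2 + α (k + 1))) • (x (k + 1) - x k)) :
    ∀ k, v (k + 1) = x (k + 1) + ((1 - α k) / α k) • (x (k + 1) - x k) := by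
  have hz1 : ∀ k, ζ (k + 1) = δ * (α k) ^ 2 := by
    intro k
    induction k with
    | zero =>
      have h1 : (1 - α 0) ≠ 0 := by have := (hα 0).2; intro h; linarith
      rw [hζ 0, hζ0]
      field_simp
      ring
    | succ k ih => rw [hζ (k + 1), ih, hαrec k]
  -- one step, given the key relation
  have step : ∀ k, (∀ i, (1 - α k) * ζ k * v k i
        = (δ * α k - α k * μM) * z k i - δ * α k * (1 - α k) * x k i) →
      ∀ i, v (k + 1) i = x (k + 1) i + ((1 - α k) / α k) * (x (k + 1) i - x k i) := by
    intro k h i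
    have ha : α k ≠ 0 := (hα k).1.ne'
    have hd0 : δ ≠ 0 := hδ.ne'
    have e1 : v (k + 1) i = ((1 - α k) * ζ k * v k i + α k * μM * z k i - α k * w k i)
        / (δ * (α k) ^ 2) := by
      rw [hv k, hz1 k]
      simp only [PiLp.add_apply, PiLp.sub_apply, PiLp.smul_apply, smul_eq_mul]
      ring
    have e2 : x (k + 1) i = z k i - (1 / δ) * w k i := by
      rw [hx k]
      simp only [PiLp.sub_apply, PiLp.smul_apply, smul_eq_mul]
    rw [e1, e2, h i]
    field_simp
    ring
  have key : ∀ k, ∀ i, (1 - α k) * ζ k * v k i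
        = (δ * α k - α k * μM) * z k i - δ * α k * (1 - α k) * x k i := by
    intro k
    induction k with
    | zero =>
      intro i
      have e : (1 - α 0) * ζ 0 = δ * (α 0) ^ 2 - α 0 * μM := by
        have := hζ 0
        have := hz1 0
        linarith
      rw [e, ← hv0, ← hx0]
      ring
    | succ k ih =>
      intro i
      have hs := step k ih i
      have ha := (hα k).1
      have hb := (hα (k + 1)).1
      have hD : (α k) ^ 2 + α (k + 1) ≠ 0 := by positivity
      have e3 : z (k + 1) i = x (k + 1) i
          + (α k * (1 - α k) / ((α k) ^ 2 + α (k + 1))) * (x (k + 1) i - x k i) := by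
        rw [hz k]
        simp only [PiLp.add_apply, PiLp.sub_apply, PiLp.smul_apply, smul_eq_mul]
      have hr := hαrec k
      have e4 : (δ * α (k + 1) - α (k + 1) * μM)
          = (1 - α (k + 1)) * δ * ((α k) ^ 2 + α (k + 1)) := by linarith
      have e5 : α k * ((1 - α k) / α k) = 1 - α k := by field_simp
      have e6 : ((α k) ^ 2 + α (k + 1)) * (α k * (1 - α k) / ((α k) ^ 2 + α (k + 1)))
          = α k * (1 - α k) := by field_simp
      rw [e4, e3, hs, hz1 k]
      linear_combination (1 - α (k + 1)) * δ * α k * (x (k + 1) i - x k i) * e5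
        - (1 - α (k + 1)) * δ * (x (k + 1) i - x k i) * e6
  intro k
  ext i
  rw [step k (key k) i]
  simp only [PiLp.add_apply, PiLp.sub_apply, PiLp.smul_apply, smul_eq_mul]
end

section
/- Closed form of the total error in the inexact estimating-sequence analysis (identity in Section 6.1.1). In the setting of the previous identity — δ > 0, μ_M ≥ 0, coefficients α^k ∈ (0,1) with δ(α^0)² > α^0μ_M and δ(α^k)² = (1−α^k)δ(α^{k−1})² + α^k μ_M for k ≥ 1, ζ^0 := (δ(α^0)²−α^0μ_M)/(1−α^0), ζ^{k+1} := (1−α^k)ζ^k + α^kμ_M, sequences x^0 = z^0 = v^0, x^{k+1} := z^k − (1/δ)(g^k + e^k), v^{k+1} := ((1−α^k)ζ^k/ζ^{k+1})v^k + (α^kμ_M/ζ^{k+1})z^k − (α^k/ζ^{k+1})(g^k+e^k), z^{k+1} := x^{k+1} + (α^k(1−α^k)/((α^k)²+α^{k+1}))(x^{k+1}−x^k), where g^k, e^k ∈ ℝ^d are arbitrary — fix x⋆ ∈ ℝ^d and define ε^k := ⟨e^k, x⋆ − z^k⟩, ε_ψ^0 := 0, ε_ψ^{k+1} := (1−α^k)ε_ψ^k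 + (1−α^k)⟨e^k, x^k − z^k⟩ + ⟨e^k + g^k, (1/δ)e^k⟩, and ε_tot^k := ε_ψ^{k+1} − (1−α^k)ε_ψ^k + α^k ε^k. Then for every k ≥ 0: ε_tot^k = ⟨e^k, α^k x⋆ + (1−α^k)x^k − x^{k+1}⟩ = α^k·⟨e^k, x⋆ − v^{k+1}⟩. -/
open scoped RealInnerProductSpace

/-- **Closed form of the total error in the inexact estimating-sequence analysis**
(identity in Section 6.1.1). In the setting of the momentum-form identity, with
`x^{k+1} = z^k − (1/δ)(g^k+e^k)`, `ε^k := ⟪e^k, x⋆−z^k⟫`, `ε_ψ^0 := 0`,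
`ε_ψ^{k+1} := (1−α^k)ε_ψ^k + (1−α^k)⟪e^k, x^k−z^k⟫ + ⟪e^k+g^k, (1/δ)e^k⟫` and
`ε_tot^k := ε_ψ^{k+1} − (1−α^k)ε_ψ^k + α^k ε^k`, one has
`ε_tot^k = ⟪e^k, α^k x⋆ + (1−α^k)x^k − x^{k+1}⟫ = α^k ⟪e^k, x⋆ − v^{k+1}⟫`. -/
theorem total_error_closed_form
    (d : ℕ) (hd : 1 ≤ d) (δ μM : ℝ) (hδ : 0 < δ) (hμM : 0 ≤ μM)
    (α : ℕ → ℝ) (hα : ∀ k, α k ∈ Set.Ioo (0 : ℝ) 1)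
    (hα0 : δ * (α 0) ^ 2 > α 0 * μM)
    (hαrec : ∀ k, δ * (α (k + 1)) ^ 2
      = (1 - α (k + 1)) * (δ * (α k) ^ 2) + α (k + 1) * μM)
    (ζ : ℕ → ℝ)
    (hζ0 : ζ 0 = (δ * (α 0) ^ 2 - α 0 * μM) / (1 - α 0))
    (hζ : ∀ k, ζ (k + 1) = (1 - α k) * ζ k + α k * μM)
    (g e x z v : ℕ → EuclideanSpace ℝ (Fin d))
    (hx0 : x 0 = z 0) (hv0 : x 0 = v 0)
    (hx : ∀ k, x (k + 1) = z k - (1 / δ) • (g k + e k))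
    (hv : ∀ k, v (k + 1) = ((1 - α k) * ζ k / ζ (k + 1)) • v k
      + (α k * μM / ζ (k + 1)) • z k - (α k / ζ (k + 1)) • (g k + e k))
    (hz : ∀ k, z (k + 1) = x (k + 1)
      + (α k * (1 - α k) / ((α k) ^ 2 + α (k + 1))) • (x (k + 1) - x k))
    (xstar : EuclideanSpace ℝ (Fin d))
    (εψ : ℕ → ℝ) (hεψ0 : εψ 0 = 0)
    (hεψ : ∀ k, εψ (k + 1) = (1 - α k) * εψ k + (1 - α k) * ⟪e k, x k - z k⟫
      + ⟪e k + g k, (1 / δ) • e k⟫) :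
    ∀ k, (εψ (k + 1) - (1 - α k) * εψ k + α k * ⟪e k, xstar - z k⟫
          = ⟪e k, α k • xstar + (1 - α k) • x k - x (k + 1)⟫)
      ∧ (εψ (k + 1) - (1 - α k) * εψ k + α k * ⟪e k, xstar - z k⟫
          = α k * ⟪e k, xstar - v (k + 1)⟫) := by
  have hζ' : ∀ k, ζ (k + 1) = δ * (α k) ^ 2 := by
    intro k
    induction k with
    | zero =>
      have h1 : (1 - α 0) ≠ 0 := by have := (hα 0).2; linarith
      rw [hζ, hζ0]
      field_simp
      ring
    | succ k ih =>
      rw [hζ, ih, hαrec]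
  -- from the weighted relation between `v k`, `z k`, `x k` to the momentum identity
  have step : ∀ k, (∀ i, (1 - α k) * ζ k * v k i
        = (δ * α k - α k * μM) * z k i - δ * α k * (1 - α k) * x k i) →
      ∀ i, α k * v (k + 1) i = x (k + 1) i - (1 - α k) * x k i := by
    intro k h i
    have ha : α k ≠ 0 := (hα k).1.ne'
    have hd' : δ ≠ 0 := hδ.ne'
    have h1 := h i
    rw [hv k, hx k, hζ' k]
    simp only [PiLp.add_apply, PiLp.sub_apply, PiLp.smul_apply, smul_eq_mul]
    field_simp
    linear_combination h1
  have Q : ∀ k, ∀ i, (1 - α k) * ζ k * v k i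
        = (δ * α k - α k * μM) * z k i - δ * α k * (1 - α k) * x k i := by
    intro k
    induction k with
    | zero =>
      intro i
      have h1 : (1 - α 0) ≠ 0 := by have := (hα 0).2; linarith
      have h2 : (1 - α 0) * ζ 0 = δ * (α 0) ^ 2 - α 0 * μM := by
        rw [hζ0]; field_simp
      rw [h2, ← hx0, ← hv0]
      ring
    | succ k ih =>
      intro i
      have h1 := step k ih i
      have ha : 0 < α k := (hα k).1
      have hb : 0 < α (k + 1) := (hα (k + 1)).1
      have hc : (α k) ^ 2 + α (k + 1) ≠ 0 := by positivity
      have h2 := hαrec k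
      have h3 : ((α k) ^ 2 + α (k + 1)) * z (k + 1) i
          = ((α k) ^ 2 + α (k + 1)) * x (k + 1) i
            + α k * (1 - α k) * (x (k + 1) i - x k i) := by
        rw [hz k]
        simp only [PiLp.add_apply, PiLp.sub_apply, PiLp.smul_apply, smul_eq_mul]
        field_simp
      rw [hζ' k]
      linear_combination (1 - α (k + 1)) * δ * α k * h1
        - δ * (1 - α (k + 1)) * h3 - z (k + 1) i * h2
  intro k
  have key : εψ (k + 1) - (1 - α k) * εψ k + α k * ⟪e k, xstar - z k⟫
      = ⟪e k, α k • xstar + (1 - α k) • x k - x (k + 1)⟫ := by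
    rw [hεψ k, hx k]
    simp only [inner_add_left, inner_add_right, inner_sub_right, inner_smul_right]
    rw [real_inner_comm (e k) (g k)]
    ring
  refine ⟨key, ?_⟩
  rw [key, ← inner_smul_right]
  congr 1
  ext i
  have h1 := step k (Q k) i
  simp only [PiLp.add_apply, PiLp.sub_apply, PiLp.smul_apply, smul_eq_mul]
  linear_combination h1
end

section
/- Uniform bound on the inner-loop length in the strongly convex regime (core of Proposition 2). Let r > 1, c_L ≥ 1, c_M > 0, D ≥ 0, ε₀ > 0 and q ∈ (0,1). Let (A_k)_{k≥0} and (B_k)_{k≥0} be nonnegative real sequences and (T_k)_{k≥0} natural numbers satisfying, for all k ≥ 0: (i) B_k ≤ c_L(1−1/r)^{T_k} A_k; (ii) A_{k+1} ≤ c_M B_k + D·q^{k−1}; (iii) T_0 ≥ r·max{0, log(c_L A_0/(ε₀ q))}; (iv) T_{k+1} ≥ r·max{0, log( c_L (c_M + D/(ε₀ q²)) / q )}. Then for every k ≥ 0: B_k ≤ ε₀·q^{k+1}. -/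
theorem contraction_aux (r x : ℝ) (n : ℕ) (hr : 1 < r) (hx : 0 ≤ x)
    (hn : (n : ℝ) ≥ r * max 0 (Real.log x)) : (1 - 1 / r) ^ n * x ≤ 1 := by
  rcases hx.eq_or_lt with h0 | hpos
  · rw [← h0]; simp
  have hr0 : 0 < r := by linarith
  have h1 : 0 ≤ 1 - 1 / r := by
    have : 1 / r ≤ 1 := by rw [div_le_one hr0]; exact hr.le
    linarith
  have h2 : 1 - 1 / r ≤ Real.exp (-(1 / r)) := by
    have := Real.add_one_le_exp (-(1 / r))
    linarith
  have h3 : (1 - 1 / r) ^ n ≤ Real.exp (-(n / r)) := by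
    calc (1 - 1 / r) ^ n ≤ Real.exp (-(1 / r)) ^ n := pow_le_pow_left₀ h1 h2 n
      _ = Real.exp (-(n / r)) := by
        rw [← Real.exp_nat_mul]; congr 1; ring
  have h4 : Real.log x ≤ n / r := by
    rw [le_div_iff₀ hr0]
    have := mul_le_mul_of_nonneg_left (le_max_right 0 (Real.log x)) hr0.le
    linarith
  calc (1 - 1 / r) ^ n * x ≤ Real.exp (-(n / r)) * x := by gcongr
    _ = Real.exp (-(n / r) + Real.log x) := by rw [Real.exp_add, Real.exp_log hpos]
    _ ≤ 1 := by rw [Real.exp_le_one_iff]; linarith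

/-- **Uniform bound on the inner-loop length in the strongly convex regime**
(core of Proposition 2). If the merit values `A_k` (start of the `k`-th inner loop) and
`B_k` (at termination after `T_k` inner iterations) satisfy the linear contraction
`B_k ≤ c_L (1−1/r)^{T_k} A_k`, the warm-start bound `A_{k+1} ≤ c_M B_k + D q^{k−1}`
(here `q^{k−1} = q^k/q`), and the inner loops are run for at least
`T_0 ≥ r·max{0, log(c_L A_0/(ε₀ q))}` and
`T_{k+1} ≥ r·max{0, log(c_L (c_M + D/(ε₀ q²))/q)}` iterations, then
`B_k ≤ ε₀ q^{k+1}` for every `k`. -/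
theorem inner_loop_uniform_bound_strongly_convex
    (r cL cM D ε₀ q : ℝ)
    (hr : 1 < r) (hcL : 1 ≤ cL) (hcM : 0 < cM) (hD : 0 ≤ D) (hε₀ : 0 < ε₀)
    (hq : q ∈ Set.Ioo (0 : ℝ) 1)
    (A B : ℕ → ℝ) (T : ℕ → ℕ)
    (hA : ∀ k, 0 ≤ A k) (hB : ∀ k, 0 ≤ B k)
    (hcontract : ∀ k, B k ≤ cL * (1 - 1 / r) ^ T k * A k)
    (hwarm : ∀ k, A (k + 1) ≤ cM * B k + D * q ^ k / q)
    (hT0 : (T 0 : ℝ) ≥ r * max 0 (Real.log (cL * A 0 / (ε₀ * q))))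
    (hTk : ∀ k, (T (k + 1) : ℝ)
      ≥ r * max 0 (Real.log (cL * (cM + D / (ε₀ * q ^ 2)) / q))) :
    ∀ k, B k ≤ ε₀ * q ^ (k + 1) := by
  obtain ⟨hq0, hq1⟩ := hq
  have hcL0 : 0 < cL := by linarith
  have hρ : 0 ≤ 1 - 1 / r := by
    have : 1 / r ≤ 1 := by rw [div_le_one (by linarith)]; exact hr.le
    linarith
  intro k
  induction k with
  | zero =>
    have h := contraction_aux r _ (T 0) hr (by have := hA 0; positivity) hT0
    calc B 0 ≤ cL * (1 - 1 / r) ^ T 0 * A 0 := hcontract 0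
      _ = ((1 - 1 / r) ^ T 0 * (cL * A 0 / (ε₀ * q))) * (ε₀ * q) := by field_simp
      _ ≤ 1 * (ε₀ * q) := by gcongr
      _ = ε₀ * q ^ (0 + 1) := by ring
  | succ k ih =>
    have h := contraction_aux r _ (T (k + 1)) hr (by positivity) (hTk k)
    have hAk : A (k + 1) ≤ ε₀ * q ^ (k + 1) * (cM + D / (ε₀ * q ^ 2)) := by
      calc A (k + 1) ≤ cM * B k + D * q ^ k / q := hwarm k
        _ ≤ cM * (ε₀ * q ^ (k + 1)) + D * q ^ k / q := by gcongr
        _ = ε₀ * q ^ (k + 1) * (cM + D / (ε₀ * q ^ 2)) := by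
          rw [pow_succ]; field_simp
    calc B (k + 1) ≤ cL * (1 - 1 / r) ^ T (k + 1) * A (k + 1) := hcontract _
      _ ≤ cL * (1 - 1 / r) ^ T (k + 1) * (ε₀ * q ^ (k + 1) * (cM + D / (ε₀ * q ^ 2))) := by
        apply mul_le_mul_of_nonneg_left hAk
        exact mul_nonneg hcL0.le (pow_nonneg hρ _)
      _ = ((1 - 1 / r) ^ T (k + 1) * (cL * (cM + D / (ε₀ * q ^ 2)) / q))
            * (ε₀ * q ^ (k + 1 + 1)) := by
        generalize (1 - 1 / r) ^ T (k + 1) = P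
        generalize cM + D / (ε₀ * q ^ 2) = X
        rw [pow_succ q (k + 1)]; field_simp
      _ ≤ 1 * (ε₀ * q ^ (k + 1 + 1)) := by gcongr
      _ = ε₀ * q ^ (k + 1 + 1) := one_mul _
end

section
/- Logarithmically growing bound on the inner-loop length in the convex regime (core of Proposition 4). Let r > 1, c_L ≥ 1, c_M > 0, W ≥ 0, ε₀ > 0, r₀ > 0, and set s := 4 + 2r₀. Let (A_k)_{k≥0} and (B_k)_{k≥0} be nonnegative real sequences and (T_k)_{k≥0} natural numbers satisfying, for all k ≥ 0: (i) B_k ≤ c_L(1−1/r)^{T_k} A_k; (ii) A_{k+1} ≤ c_M B_k + W; (iii) T_0 ≥ r·max{0, log(c_L·3^s·A_0/ε₀)}; (iv) T_{k+1} ≥ r·max{0, log( c_L c_M 2^s + c_L W (k+4)^s/ε₀ )}. Then for every k ≥ 0: B_k ≤ ε₀/(k+3)^s. -/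
theorem aux_contract (r X : ℝ) (n : ℕ) (hr : 1 < r) (hX : 0 ≤ X)
    (hn : (n : ℝ) ≥ r * max 0 (Real.log X)) : (1 - 1 / r) ^ n * X ≤ 1 := by
  rcases hX.eq_or_lt with h | h
  · rw [← h]; simp
  have hr0 : 0 < r := by linarith
  have h1 : 1 / r ≤ 1 := by rw [div_le_one hr0]; exact hr.le
  have h2 : (1 - 1 / r) ≤ Real.exp (-(1 / r)) := by
    have := Real.add_one_le_exp (-(1 / r)); linarith
  have h3 : (1 - 1 / r) ^ n ≤ Real.exp (-(1 / r)) ^ n :=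
    pow_le_pow_left₀ (by linarith) h2 n
  rw [← Real.exp_nat_mul] at h3
  have h4 : r * Real.log X ≤ n :=
    le_trans (mul_le_mul_of_nonneg_left (le_max_right _ _) hr0.le) hn
  have h5 : Real.log X ≤ n * (1 / r) := by
    rw [mul_one_div, le_div_iff₀ hr0]; linarith
  calc (1 - 1 / r) ^ n * X ≤ Real.exp (n * -(1 / r)) * Real.exp (Real.log X) := by
        rw [Real.exp_log h]; exact mul_le_mul_of_nonneg_right h3 h.le
    _ = Real.exp (n * -(1 / r) + Real.log X) := by rw [Real.exp_add]
    _ ≤ 1 := by rw [Real.exp_le_one_iff]; linarith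

/-- **Logarithmically growing bound on the inner-loop length in the convex regime**
(core of Proposition 4). With `s := 4 + 2r₀`, if the merit values satisfy the linear
contraction `B_k ≤ c_L (1−1/r)^{T_k} A_k`, the warm-start bound `A_{k+1} ≤ c_M B_k + W`,
and the inner loops are run for at least `T_0 ≥ r·max{0, log(c_L 3^s A_0/ε₀)}` and
`T_{k+1} ≥ r·max{0, log(c_L c_M 2^s + c_L W (k+4)^s/ε₀)}` iterations, then
`B_k ≤ ε₀/(k+3)^s` for every `k`. -/
theorem inner_loop_log_bound_convex
    (r cL cM W ε₀ r₀ : ℝ)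
    (hr : 1 < r) (hcL : 1 ≤ cL) (hcM : 0 < cM) (hW : 0 ≤ W) (hε₀ : 0 < ε₀)
    (hr₀ : 0 < r₀)
    (A B : ℕ → ℝ) (T : ℕ → ℕ)
    (hA : ∀ k, 0 ≤ A k) (hB : ∀ k, 0 ≤ B k)
    (hcontract : ∀ k, B k ≤ cL * (1 - 1 / r) ^ T k * A k)
    (hwarm : ∀ k, A (k + 1) ≤ cM * B k + W)
    (hT0 : (T 0 : ℝ)
      ≥ r * max 0 (Real.log (cL * (3 : ℝ) ^ ((4 : ℝ) + 2 * r₀) * A 0 / ε₀)))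
    (hTk : ∀ k : ℕ, (T (k + 1) : ℝ)
      ≥ r * max 0 (Real.log (cL * cM * (2 : ℝ) ^ ((4 : ℝ) + 2 * r₀)
          + cL * W * ((k : ℝ) + 4) ^ ((4 : ℝ) + 2 * r₀) / ε₀))) :
    ∀ k : ℕ, B k ≤ ε₀ / ((k : ℝ) + 3) ^ ((4 : ℝ) + 2 * r₀) := by
  have hr0 : 0 < r := by linarith
  have hq : 0 ≤ 1 - 1 / r := by
    have h1 : 1 / r ≤ 1 := by rw [div_le_one hr0]; exact hr.le
    linarith
  have hs : 0 ≤ (4 : ℝ) + 2 * r₀ := by linarith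
  generalize (4 : ℝ) + 2 * r₀ = s at *
  have hcL0 : 0 < cL := by linarith
  intro k
  induction k with
  | zero =>
    have h3 : (0 : ℝ) < 3 ^ s := by positivity
    have hA0 := hA 0
    have h := aux_contract r _ (T 0) hr (by positivity) hT0
    have hc := hcontract 0
    rw [Nat.cast_zero, zero_add, le_div_iff₀ h3]
    rw [← mul_div_assoc, div_le_one hε₀] at h
    calc B 0 * 3 ^ s ≤ (cL * (1 - 1 / r) ^ T 0 * A 0) * 3 ^ s :=
          mul_le_mul_of_nonneg_right hc h3.le
      _ = (1 - 1 / r) ^ T 0 * (cL * 3 ^ s * A 0) := by ring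
      _ ≤ ε₀ := h
  | succ k ih =>
    have e : ((k + 1 : ℕ) : ℝ) + 3 = (k : ℝ) + 4 := by push_cast; ring
    rw [e]
    have p3 : (0 : ℝ) < ((k : ℝ) + 3) ^ s := by positivity
    have p4 : (0 : ℝ) < ((k : ℝ) + 4) ^ s := by positivity
    have h := aux_contract r _ (T (k + 1)) hr (by positivity) (hTk k)
    have hk : (0 : ℝ) ≤ k := Nat.cast_nonneg k
    have h24 : ((k : ℝ) + 4) ^ s ≤ 2 ^ s * ((k : ℝ) + 3) ^ s := by
      rw [← Real.mul_rpow (by norm_num) (by linarith)]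
      exact Real.rpow_le_rpow (by linarith) (by linarith) hs
    have hB4 : B k * ((k : ℝ) + 4) ^ s ≤ 2 ^ s * ε₀ := by
      rw [le_div_iff₀ p3] at ih
      calc B k * ((k : ℝ) + 4) ^ s ≤ B k * (2 ^ s * ((k : ℝ) + 3) ^ s) :=
            mul_le_mul_of_nonneg_left h24 (hB k)
        _ = 2 ^ s * (B k * ((k : ℝ) + 3) ^ s) := by ring
        _ ≤ 2 ^ s * ε₀ := mul_le_mul_of_nonneg_left ih (by positivity)
    have hQ : 0 ≤ cL * (1 - 1 / r) ^ T (k + 1) := by positivity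
    rw [le_div_iff₀ p4]
    calc B (k + 1) * ((k : ℝ) + 4) ^ s
        ≤ (cL * (1 - 1 / r) ^ T (k + 1) * (cM * B k + W)) * ((k : ℝ) + 4) ^ s :=
          mul_le_mul_of_nonneg_right
            ((hcontract (k + 1)).trans (mul_le_mul_of_nonneg_left (hwarm k) hQ)) p4.le
      _ = cL * (1 - 1 / r) ^ T (k + 1)
            * (cM * (B k * ((k : ℝ) + 4) ^ s) + W * ((k : ℝ) + 4) ^ s) := by ring
      _ ≤ cL * (1 - 1 / r) ^ T (k + 1)
            * (cM * (2 ^ s * ε₀) + W * ((k : ℝ) + 4) ^ s) := by gcongr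
      _ = ((1 - 1 / r) ^ T (k + 1)
            * (cL * cM * 2 ^ s + cL * W * ((k : ℝ) + 4) ^ s / ε₀)) * ε₀ := by
          field_simp
      _ ≤ 1 * ε₀ := mul_le_mul_of_nonneg_right h hε₀.le
      _ = ε₀ := one_mul _
end

section
/- Warm-start inequality for successive proximal subproblems (key inequality in the proof of Lemma 2, Appendix B.1). Let d, m ≥ 1, μ ≥ 0 and δ > 0, and let u : ℝ^d → ℝ be convex and μ-strongly convex. For z = (z_1,…,z_m) ∈ (ℝ^d)^m, define u_z(x) := u(x) + (δ/(2m))∑_{i=1}^m ‖x − z_i‖², let x_z denote its unique minimizer, and set z̄ := (1/m)∑_{i=1}^m z_i. Then for all z, z' ∈ (ℝ^d)^m and all points x_1,…,x_m ∈ ℝ^d: (2/((μ+δ)m))·∑_{i=1}^m (u_{z'}(x_i) − u_{z'}(x_{z'})) ≤ (4/((μ+δ)m))·∑_{i=1}^m (u_z(x_i) − u_z(x_z)) + (2δ²/((δ+μ)²))·‖z̄ − z̄'‖². -/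
lemma ws_growth {E : Type*} [NormedAddCommGroup E] [InnerProductSpace ℝ E]
    (g : E → ℝ) (hg : ConvexOn ℝ Set.univ g) (l : ℝ) (v a : E) (hl : 0 < l)
    (hmin : ∀ y, g a + l / 2 * ‖a‖ ^ 2 - inner ℝ a v ≤ g y + l / 2 * ‖y‖ ^ 2 - inner ℝ y v)
    (y : E) :
    l / 2 * ‖y - a‖ ^ 2 ≤
      (g y + l / 2 * ‖y‖ ^ 2 - inner ℝ y v) - (g a + l / 2 * ‖a‖ ^ 2 - inner ℝ a v) := by
  set R := (g y + l / 2 * ‖y‖ ^ 2 - inner ℝ y v) - (g a + l / 2 * ‖a‖ ^ 2 - inner ℝ a v) with hR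
  set K := l / 2 * ‖y - a‖ ^ 2 with hK
  have key : ∀ t : ℝ, 0 < t → t < 1 → (1 - t) * K ≤ R := by
    intro t h0 h1
    have h := hmin ((1 - t) • a + t • y)
    have hc := hg.2 (Set.mem_univ a) (Set.mem_univ y) (by linarith : 0 ≤ 1 - t) h0.le (by ring)
    simp only [smul_eq_mul] at hc
    have e1 : ‖(1 - t) • a + t • y‖ ^ 2
        = (1 - t) * ‖a‖ ^ 2 + t * ‖y‖ ^ 2 - t * (1 - t) * ‖y - a‖ ^ 2 := by
      rw [norm_add_sq_real, norm_sub_sq_real, norm_smul, norm_smul, inner_smul_left,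
        inner_smul_right, real_inner_comm y a, mul_pow, mul_pow, Real.norm_eq_abs,
        Real.norm_eq_abs, sq_abs, sq_abs]
      simp
      ring
    have e2 : inner ℝ ((1 - t) • a + t • y) v = (1 - t) * inner ℝ a v + t * inner ℝ y v := by
      rw [inner_add_left, inner_smul_left, inner_smul_left]; simp
    rw [e1, e2] at h
    have : t * ((1 - t) * K) ≤ t * R := by
      rw [hK, hR]; linarith
    exact le_of_mul_le_mul_left this h0
  have hR0 : 0 ≤ R := by have := hmin y; linarith
  by_contra hlt
  push Not at hlt
  have hK0 : 0 < K := by linarith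
  have h := key ((K - R) / (2 * K)) (by apply div_pos <;> linarith)
    (by rw [div_lt_one (by linarith)]; linarith)
  have : (1 - (K - R) / (2 * K)) * K = (K + R) / 2 := by field_simp; ring
  linarith

lemma ws_sum {E : Type*} [NormedAddCommGroup E] [InnerProductSpace ℝ E] (m : ℕ) (hm : 1 ≤ m)
    (δ : ℝ) (z : Fin m → E) (x : E) :
    δ / (2 * m) * ∑ j, ‖x - z j‖ ^ 2 = δ / 2 * ‖x‖ ^ 2
      - inner ℝ x (δ • ((m : ℝ)⁻¹ • ∑ i, z i)) + δ / (2 * m) * ∑ j, ‖z j‖ ^ 2 := by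
  have hm' : (m : ℝ) ≠ 0 := by positivity
  simp only [norm_sub_sq_real, Finset.sum_add_distrib, Finset.sum_sub_distrib, inner_smul_right,
    inner_sum, ← Finset.mul_sum]
  simp
  field_simp

lemma ws_point {E : Type*} [NormedAddCommGroup E] [InnerProductSpace ℝ E]
    (l : ℝ) (hl : 0 < l) (x a a' w : E) :
    inner ℝ (x - a') w ≤ l / 2 * ‖x - a‖ ^ 2 + l / 2 * ‖a' - a‖ ^ 2 + 1 / l * ‖w‖ ^ 2 := by
  have h1 := parallelogram_law_with_norm ℝ (x - a) (a' - a)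
  rw [sub_sub_sub_cancel_right] at h1
  have h2 := sq_nonneg ‖x - a + (a' - a)‖
  have h3 := real_inner_le_norm (x - a') w
  have h4 := sq_nonneg (l / 2 * ‖x - a'‖ - ‖w‖)
  have h5 : ‖x - a'‖ * ‖w‖ ≤ l / 4 * ‖x - a'‖ ^ 2 + 1 / l * ‖w‖ ^ 2 := by
    have : l / 4 * ‖x - a'‖ ^ 2 + 1 / l * ‖w‖ ^ 2 - ‖x - a'‖ * ‖w‖
      = 1 / l * (l / 2 * ‖x - a'‖ - ‖w‖) ^ 2 := by field_simp; ring
    have : 0 ≤ 1 / l * (l / 2 * ‖x - a'‖ - ‖w‖) ^ 2 := by positivity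
    linarith
  have h6 : l / 4 * ‖x - a'‖ ^ 2 ≤ l / 2 * ‖x - a‖ ^ 2 + l / 2 * ‖a' - a‖ ^ 2 := by
    nlinarith
  linarith

/-- **Warm-start inequality for successive proximal subproblems** (key inequality in the
proof of Lemma 2, Appendix B.1). For `u_z(x) := u(x) + (δ/(2m))∑_i ‖x−z_i‖²` with
minimizer `x_z` and `z̄ := (1/m)∑_i z_i`, one has for all `z, z'` and all points
`x_1,…,x_m`:
`(2/((μ+δ)m))∑_i (u_{z'}(x_i)−u_{z'}(x_{z'}))
  ≤ (4/((μ+δ)m))∑_i (u_z(x_i)−u_z(x_z)) + (2δ²/((δ+μ)²))‖z̄−z̄'‖²`. -/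
theorem warm_start_inequality
    (d m : ℕ) (hd : 1 ≤ d) (hm : 1 ≤ m) (μ δ : ℝ) (hμ : 0 ≤ μ) (hδ : 0 < δ)
    (u : EuclideanSpace ℝ (Fin d) → ℝ)
    (hconv : ConvexOn ℝ Set.univ u)
    (hsconv : ConvexOn ℝ Set.univ (fun x => u x - μ / 2 * ‖x‖ ^ 2))
    (xz : (Fin m → EuclideanSpace ℝ (Fin d)) → EuclideanSpace ℝ (Fin d))
    (hxz : ∀ (zz : Fin m → EuclideanSpace ℝ (Fin d)) (y : EuclideanSpace ℝ (Fin d)),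
      u (xz zz) + δ / (2 * m) * ∑ i, ‖xz zz - zz i‖ ^ 2
        ≤ u y + δ / (2 * m) * ∑ i, ‖y - zz i‖ ^ 2) :
    ∀ (z z' xs : Fin m → EuclideanSpace ℝ (Fin d)),
      2 / ((μ + δ) * m) * ∑ i,
          ((u (xs i) + δ / (2 * m) * ∑ j, ‖xs i - z' j‖ ^ 2)
            - (u (xz z') + δ / (2 * m) * ∑ j, ‖xz z' - z' j‖ ^ 2))
        ≤ 4 / ((μ + δ) * m) * ∑ i,
              ((u (xs i) + δ / (2 * m) * ∑ j, ‖xs i - z j‖ ^ 2)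
                - (u (xz z) + δ / (2 * m) * ∑ j, ‖xz z - z j‖ ^ 2))
          + 2 * δ ^ 2 / (δ + μ) ^ 2
            * ‖(m : ℝ)⁻¹ • ∑ i, z i - (m : ℝ)⁻¹ • ∑ i, z' i‖ ^ 2 := by
  intro z z' xs
  have hl : 0 < μ + δ := by linarith
  have hm' : (0 : ℝ) < m := by exact_mod_cast hm
  have hx := hxz z
  simp only [ws_sum m hm δ] at hx ⊢
  set b := (m : ℝ)⁻¹ • ∑ i, z i
  set b' := (m : ℝ)⁻¹ • ∑ i, z' i
  set c := δ / (2 * m) * ∑ j, ‖z j‖ ^ 2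
  set c' := δ / (2 * m) * ∑ j, ‖z' j‖ ^ 2
  have G := ws_growth _ hsconv (μ + δ) (δ • b) (xz z) hl
    (fun y => by have := hx y; linarith)
  have P : ∀ i, ((u (xs i) + (δ / 2 * ‖xs i‖ ^ 2 - inner ℝ (xs i) (δ • b') + c'))
      - (u (xz z') + (δ / 2 * ‖xz z'‖ ^ 2 - inner ℝ (xz z') (δ • b') + c')))
      ≤ 2 * ((u (xs i) + (δ / 2 * ‖xs i‖ ^ 2 - inner ℝ (xs i) (δ • b) + c))
      - (u (xz z) + (δ / 2 * ‖xz z‖ ^ 2 - inner ℝ (xz z) (δ • b) + c)))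
      + δ ^ 2 / (μ + δ) * ‖b - b'‖ ^ 2 := by
    intro i
    have g1 := G (xs i)
    have g2 := G (xz z')
    have g3 := ws_point (μ + δ) hl (xs i) (xz z) (xz z') (δ • (b - b'))
    rw [norm_smul, mul_pow, Real.norm_eq_abs, sq_abs, smul_sub, inner_sub_left, inner_sub_right,
      inner_sub_right] at g3
    have e : 1 / (μ + δ) * (δ ^ 2 * ‖b - b'‖ ^ 2) = δ ^ 2 / (μ + δ) * ‖b - b'‖ ^ 2 := by ring
    rw [e] at g3
    linarith
  have S := Finset.sum_le_sum (fun i (_ : i ∈ Finset.univ) => P i)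
  rw [Finset.sum_add_distrib, ← Finset.mul_sum] at S
  rw [Finset.sum_const, Finset.card_univ, Fintype.card_fin, nsmul_eq_mul] at S
  have T := mul_le_mul_of_nonneg_left S (by positivity : 0 ≤ 2 / ((μ + δ) * m))
  refine T.trans (le_of_eq ?_)
  rw [mul_add]
  congr 1
  · ring
  · rw [add_comm δ μ]; field_simp
end
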